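/- arXiv:2310.18980 — 2 statements merged into one kernel-verified Lean document; each statement's English description precedes it below -/
import Mathlib

section
/- Let r ≥ 3 and k ≥ 1 be integers, let C ≥ 4er^2·binom(k+r-2, r-1)·((2k+2r-3)e)^{1/binom(k+r-2, r-1)}, and let p = C·n^{-1/binom(k+r-2, r-1)}. There exists a constant D > 0 depending only on r and k such that for all sufficiently large n and every cyclic ordering σ ∈ Q_n, one has (1/|Q_n|) · Σ_{b=1}^{m} N_σ(b)·p^{-b} ≤ D, where m = binom(k+r-2, r-1)·n. -/
open scoped Classical
open Finset

noncomputable section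

/-- The window of `k+r-1` cyclically consecutive vertices starting at position `i`,
under the cyclic ordering `σ`. -/
def cycWindow (k r n : ℕ) (σ : ZMod n → Fin n) (i : ZMod n) : Finset (Fin n) :=
  (Finset.range (k + r - 1)).image fun j => σ (i + (j : ZMod n))

/-- The edge set of the `k`th power of a tight Hamilton cycle on `[n]` associated with
the cyclic ordering `σ`: all `r`-sets contained in some window of `k+r-1`
cyclically consecutive vertices. -/
def hamPowEdges (r k n : ℕ) (σ : ZMod n → Fin n) : Finset (Finset (Fin n)) :=
  Finset.univ.filter fun e => e.card = r ∧ ∃ i : ZMod n, e ⊆ cycWindow k r n σ i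

/-- All `r`-element subsets of `Fin n`. -/
def rSets (n r : ℕ) : Finset (Finset (Fin n)) := Finset.univ.filter fun e => e.card = r

/-- The probability weight of a given `r`-graph `H` in the binomial random
`r`-graph `H^{(r)}(n,p)`. -/
def prW (n r : ℕ) (p : ℝ) (H : Finset (Finset (Fin n))) : ℝ :=
  p ^ H.card * (1 - p) ^ ((rSets n r).card - H.card)

/-- The probability that `H^{(r)}(n,p)` satisfies the property `A`. -/
def probOf (n r : ℕ) (p : ℝ) (A : Finset (Finset (Fin n)) → Prop) : ℝ :=
  ∑ H ∈ (rSets n r).powerset, if A H then prW n r p H else 0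

/-- The expectation of `f` with respect to the random `r`-graph `H^{(r)}(n,p)`. -/
def expct (n r : ℕ) (p : ℝ) (f : Finset (Finset (Fin n)) → ℝ) : ℝ :=
  ∑ H ∈ (rSets n r).powerset, prW n r p H * f H

/-- `H` contains (a spanning copy of) the `k`th power of a tight Hamilton cycle. -/
def containsHamPow (r k n : ℕ) (H : Finset (Finset (Fin n))) : Prop :=
  ∃ σ : ZMod n → Fin n, Function.Bijective σ ∧ hamPowEdges r k n σ ⊆ H

/-- Degree of a vertex in a hypergraph given by its edge set. -/
def degOf (n : ℕ) (H : Finset (Finset (Fin n))) (v : Fin n) : ℕ :=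
  (H.filter fun e => v ∈ e).card

/-- The auxiliary graph on the edges of a hypergraph `P`, two edges being adjacent
iff they are distinct and share a vertex. -/
def edgeGraph {n : ℕ} (P : Finset (Finset (Fin n))) : SimpleGraph {e // e ∈ P} :=
  SimpleGraph.fromRel fun e f => (e.1 ∩ f.1).Nonempty

/-- The number of connected components of the hypergraph with edge set `P`. -/
def numComp {n : ℕ} (P : Finset (Finset (Fin n))) : ℕ :=
  Nat.card (edgeGraph P).ConnectedComponent

/-- The set of vertices covered by the edges of `P`. -/
def vertsOf {n : ℕ} (P : Finset (Finset (Fin n))) : Finset (Fin n) := P.biUnion id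

/-- `σ` is the canonical representative of a cyclic ordering of `[n]`
(a permutation considered up to rotation and reflection). -/
def IsCycRep (n : ℕ) (σ : ZMod n → Fin n) : Prop :=
  Function.Bijective σ ∧ (σ 0).val = 0 ∧ (σ 1).val < (σ (-1)).val

/-- `|Q_n|`, the number of cyclic orderings of `[n]`. -/
def QCard (n : ℕ) : ℕ := Nat.card {σ : ZMod n → Fin n // IsCycRep n σ}

/-- `N_σ(b)`: the number of cyclic orderings `τ ∈ Q_n` such that `H_σ` and `H_τ`
share exactly `b` edges. -/
def NQ (r k n : ℕ) (σ : ZMod n → Fin n) (b : ℕ) : ℕ :=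
  Nat.card {τ : ZMod n → Fin n //
    IsCycRep n τ ∧ (hamPowEdges r k n σ ∩ hamPowEdges r k n τ).card = b}

/-- `N_σ(b,s)`: the number of cyclic orderings `τ ∈ Q_n` such that `H_σ ∩ H_τ`
has exactly `b` edges and exactly `s` connected components. -/
def NQs (r k n : ℕ) (σ : ZMod n → Fin n) (b s : ℕ) : ℕ :=
  Nat.card {τ : ZMod n → Fin n //
    IsCycRep n τ ∧ (hamPowEdges r k n σ ∩ hamPowEdges r k n τ).card = b ∧
      numComp (hamPowEdges r k n σ ∩ hamPowEdges r k n τ) = s}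

/-- The random variable `X`: the number of cyclic orderings `σ ∈ Q_n` with `H_σ ⊆ H`. -/
def XH (r k n : ℕ) (H : Finset (Finset (Fin n))) : ℝ :=
  Nat.card {σ : ZMod n → Fin n // IsCycRep n σ ∧ hamPowEdges r k n σ ⊆ H}

/-- The auxiliary graph on a finite set `P` of edges of a simple graph, two edges
being adjacent iff they are distinct and share a vertex. -/
def edgeGraphS {V : Type*} (P : Finset (Sym2 V)) : SimpleGraph {e // e ∈ P} :=
  SimpleGraph.fromRel fun e f => ∃ x, x ∈ e.1 ∧ x ∈ f.1

/-- A labelling `ℓ` of positions by `none`, `some true`, `some false` is compatible with the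
values `f` if each `true` position has its value in `C₁`-distance from an earlier labelled position
at distance at most `q`, and each `false` position has its value in `C₂`-distance from some
earlier position at distance at most `q`. -/
def Compat {G : Type*} [AddCommGroup G] (q : ℕ) (C₁ C₂ : Finset G) {m : ℕ}
    (ℓ : Fin m → Option Bool) (f : Fin m → G) : Prop :=
  ∀ i, (ℓ i = some true → ∃ j < i, i.val ≤ j.val + q ∧ ℓ j ≠ none ∧ f i - f j ∈ C₁) ∧
    (ℓ i = some false → ∃ j < i, i.val ≤ j.val + q ∧ f i - f j ∈ C₂)

/-- The weight of a label. -/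
def labelWeight (a b : ℝ) : Option Bool → ℝ
  | none => 1
  | some true => a
  | some false => b

/-- The potential of a labelling: labelled positions near the right end contribute linearly. -/
def potential (q : ℕ) {m : ℕ} (ℓ : Fin m → Option Bool) : ℝ :=
  1 + ∑ j, if ℓ j = none then 0 else ((j.val + q + 1 - m : ℕ) : ℝ)

/-- The labelled positions among the last `q` ones. -/
def recentLabelled (q : ℕ) {m : ℕ} (ℓ : Fin m → Option Bool) : Finset (Fin m) :=
  univ.filter fun j => m ≤ j.val + q ∧ ℓ j ≠ none

theorem card_filter_recent_le (q m : ℕ) :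
    (univ.filter fun j : Fin m => m ≤ j.val + q).card ≤ q := by
  calc _ ≤ (Finset.Ico (m - q) m).card := by
        refine Finset.card_le_card_of_injOn (fun j => j.val) ?_ (fun x _ y _ h => Fin.ext h)
        intro j hj
        simp only [coe_filter, mem_univ, true_and, Set.mem_ofPred_eq] at hj
        simp only [coe_Ico, Set.mem_Ico]
        omega
    _ ≤ q := by rw [Nat.card_Ico]; omega

theorem compat_snoc {G : Type*} [AddCommGroup G] (q : ℕ) (C₁ C₂ : Finset G) {m : ℕ}
    (ℓ : Fin m → Option Bool) (f : Fin m → G) (o : Option Bool) (z : G) :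
    Compat q C₁ C₂ (Fin.snoc ℓ o : Fin (m + 1) → Option Bool) (Fin.snoc f z : Fin (m + 1) → G) ↔
      Compat q C₁ C₂ ℓ f ∧
        (o = some true → ∃ j : Fin m, m ≤ j.val + q ∧ ℓ j ≠ none ∧ z - f j ∈ C₁) ∧
        (o = some false → ∃ j : Fin m, m ≤ j.val + q ∧ z - f j ∈ C₂) := by
  unfold Compat
  rw [Fin.forall_fin_succ']
  have h : ∀ i : Fin m, ¬ Fin.last m < i.castSucc := fun i => (Fin.castSucc_lt_last i).not_gt
  simp [Fin.exists_fin_succ', Fin.castSucc_lt_last, h]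

theorem potential_snoc (q : ℕ) {m : ℕ} (ℓ : Fin m → Option Bool) (o : Option Bool) :
    potential q (Fin.snoc ℓ o : Fin (m + 1) → Option Bool) =
      potential q ℓ - (recentLabelled q ℓ).card + if o = none then 0 else (q : ℝ) := by
  unfold potential recentLabelled
  rw [Fin.sum_univ_castSucc, card_filter]
  simp only [Fin.snoc_castSucc, Fin.snoc_last, Fin.val_castSucc, Fin.val_last]
  have h : ∀ j : Fin m, (if ℓ j = none then (0 : ℝ) else ((j.val + q + 1 - (m + 1) : ℕ) : ℝ)) =
      (if ℓ j = none then (0 : ℝ) else ((j.val + q + 1 - m : ℕ) : ℝ)) -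
        ((if m ≤ j.val + q ∧ ℓ j ≠ none then 1 else 0 : ℕ) : ℝ) := by
    intro j
    by_cases h1 : ℓ j = none
    · simp [h1]
    · by_cases h2 : m ≤ j.val + q
      · have : j.val + q + 1 - m = (j.val + q + 1 - (m + 1)) + 1 := by omega
        simp only [h1, h2, if_false, this, ne_eq, not_false_eq_true, and_self, if_true]
        push_cast
        ring
      · have h3 : j.val + q + 1 - m = 0 := by omega
        have h4 : j.val + q + 1 - (m + 1) = 0 := by omega
        simp [h2, h3, h4]
  rw [Finset.sum_congr rfl fun j _ => h j, Finset.sum_sub_distrib]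
  have h5 : m + q + 1 - (m + 1) = q := by omega
  rw [h5]
  push_cast
  ring

theorem potential_snoc_none_bounds (q : ℕ) {m : ℕ} (ℓ : Fin m → Option Bool) :
    1 ≤ potential q (Fin.snoc ℓ none : Fin (m + 1) → Option Bool) ∧
      potential q (Fin.snoc ℓ none : Fin (m + 1) → Option Bool) ≤ 1 + (q : ℝ) ^ 2 := by
  unfold potential
  constructor
  · have : (0 : ℝ) ≤ ∑ j, if (Fin.snoc ℓ none : Fin (m + 1) → Option Bool) j = none then 0
        else ((j.val + q + 1 - (m + 1) : ℕ) : ℝ) :=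
      Finset.sum_nonneg fun j _ => by split_ifs <;> positivity
    linarith
  · rw [Fin.sum_univ_castSucc]
    simp only [Fin.snoc_castSucc, Fin.snoc_last, Fin.val_castSucc, if_true, add_zero]
    have h : ∀ j : Fin m, (if ℓ j = none then (0 : ℝ) else ((j.val + q + 1 - (m + 1) : ℕ) : ℝ)) ≤
        (if m ≤ j.val + q then (q : ℝ) else 0) := by
      intro j
      have hj := j.isLt
      split_ifs
      · positivity
      · exact le_rfl
      · exact_mod_cast (by omega : j.val + q + 1 - (m + 1) ≤ q)
      · have : j.val + q + 1 - (m + 1) = 0 := by omega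
        simp [this]
    have h2 := Finset.sum_le_sum fun j (_ : j ∈ univ) => h j
    rw [← Finset.sum_filter, Finset.sum_const, nsmul_eq_mul] at h2
    have h3 : ((univ.filter fun j : Fin m => m ≤ j.val + q).card : ℝ) ≤ q := by
      exact_mod_cast card_filter_recent_le q m
    nlinarith

theorem sum_label_step {G : Type*} [AddCommGroup G] [Fintype G] (q : ℕ) (C₁ C₂ : Finset G)
    {a b : ℝ} (ha : 0 ≤ a) (hb : 0 ≤ b)
    (hab : a * C₁.card * (1 + q + (q : ℝ) ^ 2) ≤ Fintype.card G) {m : ℕ}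
    (ℓ : Fin m → Option Bool) (f : Fin m → G) :
    ∑ x : Option Bool × G,
      (if (x.1 = some true → ∃ j : Fin m, m ≤ j.val + q ∧ ℓ j ≠ none ∧ x.2 - f j ∈ C₁) ∧
          (x.1 = some false → ∃ j : Fin m, m ≤ j.val + q ∧ x.2 - f j ∈ C₂) then
        labelWeight a b x.1 * potential q (Fin.snoc ℓ x.1 : Fin (m + 1) → Option Bool) else 0) ≤
      (Fintype.card G + b * (q * C₂.card) * (1 + q)) * potential q ℓ := by
  obtain ⟨hp1, hp2⟩ := potential_snoc_none_bounds q ℓ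
  rw [Fintype.sum_prod_type, Fintype.sum_option, Fintype.sum_bool]
  simp only [potential_snoc, labelWeight, if_true, reduceCtorEq, if_false, false_implies,
    true_implies, and_true, true_and, Option.some.injEq, Bool.false_eq_true, Bool.true_eq_false,
    add_zero] at *
  set p := potential q ℓ
  set s := recentLabelled q ℓ
  rw [← Finset.sum_filter, ← Finset.sum_filter]
  simp only [Finset.sum_const, nsmul_eq_mul, card_univ]
  have hc1 : ((univ.filter fun z : G =>
      ∃ j : Fin m, m ≤ j.val + q ∧ ℓ j ≠ none ∧ z - f j ∈ C₁).card : ℝ) ≤ s.card * C₁.card := by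
    rw [← Nat.cast_mul]
    refine Nat.cast_le.2
      ((Finset.card_le_card (t := s.biUnion fun j => C₁.image (· + f j)) ?_).trans
      (Finset.card_biUnion_le_card_mul _ _ _ fun j _ => Finset.card_image_le))
    intro z hz
    obtain ⟨j, h1, h2, h3⟩ := (mem_filter.1 hz).2
    exact mem_biUnion.2 ⟨j, mem_filter.2 ⟨mem_univ _, h1, h2⟩, mem_image.2 ⟨_, h3, by simp⟩⟩
  have hc2 : ((univ.filter fun z : G =>
      ∃ j : Fin m, m ≤ j.val + q ∧ z - f j ∈ C₂).card : ℝ) ≤ q * C₂.card := by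
    rw [← Nat.cast_mul]
    refine Nat.cast_le.2 ((Finset.card_le_card
      (t := (univ.filter fun j : Fin m => m ≤ j.val + q).biUnion
        fun j => C₂.image (· + f j)) ?_).trans
      ((Finset.card_biUnion_le_card_mul _ _ _ fun j _ => Finset.card_image_le).trans
        (Nat.mul_le_mul_right _ (card_filter_recent_le q m))))
    intro z hz
    obtain ⟨j, h1, h3⟩ := (mem_filter.1 hz).2
    exact mem_biUnion.2 ⟨j, mem_filter.2 ⟨mem_univ _, h1⟩, mem_image.2 ⟨_, h3, by simp⟩⟩
  have hN : (0 : ℝ) ≤ Fintype.card G := by positivity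
  have hq : (0 : ℝ) ≤ q := by positivity
  have hs : (0 : ℝ) ≤ s.card := by positivity
  have hpq : 0 ≤ p - s.card + q := by linarith
  have e1 : (s.card * C₁.card : ℝ) * (a * (p - s.card + q)) ≤ s.card * Fintype.card G := by
    calc (s.card * C₁.card : ℝ) * (a * (p - s.card + q))
        ≤ (s.card * C₁.card : ℝ) * (a * (1 + q + (q : ℝ) ^ 2)) := by
          refine mul_le_mul_of_nonneg_left (mul_le_mul_of_nonneg_left ?_ ha) (by positivity)
          linarith
      _ = s.card * (a * C₁.card * (1 + q + (q : ℝ) ^ 2)) := by ring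
      _ ≤ _ := by gcongr
  have e2 : (q * C₂.card : ℝ) * (b * (p - s.card + q)) ≤
      (q * C₂.card : ℝ) * (b * ((1 + q) * p)) := by
    gcongr
    nlinarith
  have e3 := mul_le_mul_of_nonneg_right hc1 (mul_nonneg ha hpq)
  have e4 := mul_le_mul_of_nonneg_right hc2 (mul_nonneg hb hpq)
  linarith

theorem sum_compat_le {G : Type*} [AddCommGroup G] [Fintype G] (q : ℕ) (C₁ C₂ : Finset G)
    {a b : ℝ} (ha : 0 ≤ a) (hb : 0 ≤ b)
    (hab : a * C₁.card * (1 + q + (q : ℝ) ^ 2) ≤ Fintype.card G) (m : ℕ) :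
    ∑ g : Fin m → Option Bool × G,
      (if Compat q C₁ C₂ (fun i => (g i).1) (fun i => (g i).2) then
        (∏ i, labelWeight a b (g i).1) * potential q (fun i => (g i).1) else 0) ≤
      (Fintype.card G + b * (q * C₂.card) * (1 + q)) ^ m := by
  have hw : ∀ o, 0 ≤ labelWeight a b o := by
    rintro (_ | _ | _) <;> simp [labelWeight, ha, hb]
  induction m with
  | zero => simp [Compat, potential]
  | succ m ih =>
    rw [← (Fin.snocEquiv fun _ => Option Bool × G).sum_comp, Fintype.sum_prod_type_right, pow_succ',
      mul_comm]
    refine le_trans ?_ (mul_le_mul_of_nonneg_right ih (by positivity))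
    rw [Finset.sum_mul]
    refine Finset.sum_le_sum fun g _ => ?_
    have hl : ∀ x : Option Bool × G,
        (fun i => ((Fin.snocEquiv fun _ => Option Bool × G) (x, g) i).1)
        = (Fin.snoc (fun i => (g i).1) x.1 : Fin (m + 1) → Option Bool) := by
      intro x; funext i
      cases i using Fin.lastCases <;> simp [Fin.snocEquiv]
    have hf : ∀ x : Option Bool × G,
        (fun i => ((Fin.snocEquiv fun _ => Option Bool × G) (x, g) i).2)
        = (Fin.snoc (fun i => (g i).2) x.2 : Fin (m + 1) → G) := by
      intro x; funext i
      cases i using Fin.lastCases <;> simp [Fin.snocEquiv]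
    have hpr : ∀ x : Option Bool × G,
        ∏ i, labelWeight a b ((Fin.snocEquiv fun _ => Option Bool × G) (x, g) i).1 =
          (∏ i, labelWeight a b (g i).1) * labelWeight a b x.1 := by
      intro x
      rw [Fin.prod_univ_castSucc]
      simp [Fin.snocEquiv]
    simp only [hl, hf, hpr, compat_snoc]
    by_cases hc : Compat q C₁ C₂ (fun i => (g i).1) (fun i => (g i).2)
    · simp only [hc, true_and, if_true]
      refine le_trans (le_of_eq ?_) ((mul_le_mul_of_nonneg_left (sum_label_step q C₁ C₂ ha hb hab
        (fun i => (g i).1) (fun i => (g i).2))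
        (Finset.prod_nonneg fun i _ => hw (g i).1)).trans (le_of_eq (by ring)))
      rw [Finset.mul_sum]
      refine Finset.sum_congr rfl fun x _ => ?_
      rw [mul_ite, mul_zero, mul_assoc]
    · simp [hc]

theorem sum_weight_card_compat_le {G : Type*} [AddCommGroup G] [Fintype G] (q : ℕ)
    (C₁ C₂ : Finset G) {a b : ℝ} (ha : 0 ≤ a) (hb : 0 ≤ b)
    (hab : a * C₁.card * (1 + q + (q : ℝ) ^ 2) ≤ Fintype.card G) (m : ℕ) :
    ∑ ℓ : Fin m → Option Bool, (∏ i, labelWeight a b (ℓ i)) *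
        ((univ.filter fun f : Fin m → G => Compat q C₁ C₂ ℓ f).card : ℝ) ≤
      (Fintype.card G + b * (q * C₂.card) * (1 + q)) ^ m := by
  have hw : ∀ o, 0 ≤ labelWeight a b o := by
    rintro (_ | _ | _) <;> simp [labelWeight, ha, hb]
  refine le_trans ?_ (sum_compat_le q C₁ C₂ ha hb hab m)
  rw [← (Equiv.arrowProdEquivProdArrow (Fin m) (fun _ => Option Bool) (fun _ => G)).symm.sum_comp,
    Fintype.sum_prod_type]
  refine Finset.sum_le_sum fun ℓ _ => ?_
  rw [← Finset.sum_boole, Finset.mul_sum]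
  refine Finset.sum_le_sum fun f _ => ?_
  change _ ≤ if Compat q C₁ C₂ ℓ f then (∏ i, labelWeight a b (ℓ i)) * potential q ℓ else 0
  split_ifs
  · rw [mul_one]
    refine le_mul_of_one_le_right (Finset.prod_nonneg fun i _ => hw _) ?_
    unfold potential
    have : (0 : ℝ) ≤ ∑ j : Fin m, if ℓ j = none then 0 else ((j.val + q + 1 - m : ℕ) : ℝ) :=
      Finset.sum_nonneg fun j _ => by split_ifs <;> positivity
    linarith
  · simp

theorem card_subtype_notMem {ι : Type*} [Fintype ι] [DecidableEq ι] (V : Finset ι) :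
    Fintype.card {i // i ∉ V} = Fintype.card ι - V.card := by
  rw [Fintype.card_subtype_compl, Fintype.card_coe]

/-- Extending functions on `V` to bijections: at most `(n - |V|)!` of them agree with any given
function on `V`. -/
theorem card_bijective_eqOn_le {ι α : Type*} [Fintype ι] [DecidableEq ι] [Fintype α] [DecidableEq α]
    (hcard : Fintype.card ι = Fintype.card α) (V : Finset ι) (b : ι → α) :
    (univ.filter fun f : ι → α => Function.Bijective f ∧ ∀ i ∈ V, f i = b i).card ≤
      (Fintype.card ι - V.card).factorial := by
  rcases Finset.eq_empty_or_nonempty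
    (univ.filter fun f : ι → α => Function.Bijective f ∧ ∀ i ∈ V, f i = b i) with h | ⟨f₀, hf₀⟩
  · rw [h]; simp
  obtain ⟨hf₀, hfb⟩ := (mem_filter.1 hf₀).2
  have hV : (V.image b).card = V.card := by
    refine Finset.card_image_of_injOn fun i hi j hj hij => hf₀.1 ?_
    rw [hfb i hi, hfb j hj, hij]
  rw [← Fintype.card_coe]
  have e : ∀ f : {f // f ∈ univ.filter fun f : ι → α =>
      Function.Bijective f ∧ ∀ i ∈ V, f i = b i}, ∀ i : {i // i ∉ V}, f.1 i ∉ V.image b := by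
    intro f i hi
    obtain ⟨hf, hfb⟩ := (mem_filter.1 f.2).2
    obtain ⟨j, hj, hji⟩ := mem_image.1 hi
    rw [← hfb j hj] at hji
    exact i.2 (hf.1 hji ▸ hj)
  refine (Fintype.card_le_of_injective
    (fun f => (⟨fun i : {i // i ∉ V} => (⟨f.1 i, e f i⟩ : {x // x ∉ V.image b}), ?_⟩ :
      {i // i ∉ V} ↪ {x // x ∉ V.image b})) ?_).trans (le_of_eq ?_)
  · intro i j hij
    exact Subtype.ext ((mem_filter.1 f.2).2.1.1 (congrArg Subtype.val hij))
  · intro f g hfg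
    refine Subtype.ext (funext fun i => ?_)
    by_cases hi : i ∈ V
    · rw [(mem_filter.1 f.2).2.2 i hi, (mem_filter.1 g.2).2.2 i hi]
    · exact congrArg Subtype.val (DFunLike.congr_fun hfg ⟨i, hi⟩)
  · rw [Fintype.card_embedding_eq, card_subtype_notMem, card_subtype_notMem, hV,
      ← hcard, Nat.descFactorial_self]

theorem card_bijective_mul_pow_le {ι α : Type*} [Fintype ι] [DecidableEq ι] [Fintype α]
    [DecidableEq α]
    (hcard : Fintype.card ι = Fintype.card α) (V : Finset ι) (p : (ι → α) → Prop)
    (hp : ∀ f g : ι → α, (∀ i ∈ V, f i = g i) → p f → p g) :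
    (univ.filter fun f : ι → α => Function.Bijective f ∧ p f).card *
        Fintype.card α ^ (Fintype.card ι - V.card) ≤
      (Fintype.card ι - V.card).factorial * (univ.filter p).card := by
  have h1 : Fintype.card ({i // i ∉ V} → α) = Fintype.card α ^ (Fintype.card ι - V.card) := by
    rw [Fintype.card_fun, card_subtype_notMem]
  rw [← h1, ← Finset.card_univ (α := {i // i ∉ V} → α), ← Finset.card_product]
  refine Finset.card_le_mul_card_image_of_maps_to
    (f := fun x i => if h : i ∈ V then x.1 i else x.2 ⟨i, h⟩) ?_ _ ?_
  · rintro ⟨f, h⟩ hx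
    have hf := (mem_filter.1 (mem_product.1 hx).1).2
    exact mem_filter.2 ⟨mem_univ _, hp f _ (fun i hi => by simp [hi]) hf.2⟩
  · intro b _
    refine le_trans (Finset.card_le_card_of_injOn (fun x => x.1) ?_ ?_)
      (card_bijective_eqOn_le hcard V b)
    · rintro ⟨f, h⟩ hx
      obtain ⟨hx1, hx2⟩ := mem_filter.1 hx
      refine mem_coe.2 (mem_filter.2 ⟨mem_univ _, (mem_filter.1 (mem_product.1 hx1).1).2.1,
        fun i hi => ?_⟩)
      rw [← hx2]
      simp [hi]
    · rintro ⟨f, h⟩ hx ⟨f', h'⟩ hx' hff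
      obtain ⟨-, hx2⟩ := mem_filter.1 hx
      obtain ⟨-, hx2'⟩ := mem_filter.1 hx'
      refine Prod.ext hff (funext fun i => ?_)
      simpa only [i.2, dite_false] using congrFun (hx2.trans hx2'.symm) i.1

theorem factorial_sub_mul_pow_le (n v : ℕ) (hv : v ≤ n) :
    ((n - v).factorial : ℝ) * (n : ℝ) ^ v ≤ Real.exp 1 ^ v * n.factorial := by
  induction n generalizing v with
  | zero =>
    obtain rfl : v = 0 := by omega
    simp
  | succ n ih =>
    rcases v with _ | v
    · simp
    have hvn : v ≤ n := by omega
    have h1 : ((n : ℝ) + 1) ^ v ≤ Real.exp 1 * (n : ℝ) ^ v := by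
      rcases Nat.eq_zero_or_pos n with rfl | hn
      · obtain rfl : v = 0 := by omega
        simp
      have hn' : (0 : ℝ) < n := by exact_mod_cast hn
      have h2 : (1 + 1 / (n : ℝ)) ^ v ≤ Real.exp 1 := by
        calc (1 + 1 / (n : ℝ)) ^ v ≤ Real.exp (1 / n) ^ v := by
              gcongr
              rw [add_comm]; exact Real.add_one_le_exp _
          _ = Real.exp (v * (1 / n)) := by rw [← Real.exp_nat_mul]
          _ ≤ Real.exp 1 := by
              gcongr
              rw [mul_one_div, div_le_one hn']
              exact_mod_cast hvn
      calc ((n : ℝ) + 1) ^ v = (1 + 1 / (n : ℝ)) ^ v * (n : ℝ) ^ v := by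
            rw [← mul_pow]; congr 1; field_simp
        _ ≤ _ := by gcongr
    have h3 := ih v hvn
    rw [Nat.add_sub_add_right, Nat.factorial_succ]
    push_cast
    calc ((n - v).factorial : ℝ) * ((n : ℝ) + 1) ^ (v + 1)
        = (n - v).factorial * ((n : ℝ) + 1) ^ v * (n + 1) := by ring
      _ ≤ (n - v).factorial * (Real.exp 1 * (n : ℝ) ^ v) * (n + 1) := by gcongr
      _ = Real.exp 1 * (n + 1) * ((n - v).factorial * (n : ℝ) ^ v) := by ring
      _ ≤ Real.exp 1 * (n + 1) * (Real.exp 1 ^ v * n.factorial) := by gcongr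
      _ = _ := by ring

/-- A uniformly random bijection satisfies a property depending only on the coordinates in `V` with
probability at most `e ^ |V|` times that of a uniformly random function. -/
theorem card_bijective_le_exp {ι α : Type*} [Fintype ι] [DecidableEq ι] [Fintype α]
    [DecidableEq α] [Nonempty α]
    (hcard : Fintype.card ι = Fintype.card α) (V : Finset ι) (p : (ι → α) → Prop)
    (hp : ∀ f g : ι → α, (∀ i ∈ V, f i = g i) → p f → p g) :
    ((univ.filter fun f : ι → α => Function.Bijective f ∧ p f).card : ℝ) *
        (Fintype.card α : ℝ) ^ Fintype.card α ≤
      Real.exp 1 ^ V.card * (Fintype.card α).factorial * (univ.filter p).card := by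
  have h := card_bijective_mul_pow_le hcard V p hp
  rw [hcard] at h
  have hv : V.card ≤ Fintype.card α := hcard ▸ Finset.card_le_univ V
  have h' : ((univ.filter fun f : ι → α => Function.Bijective f ∧ p f).card : ℝ) *
      (Fintype.card α : ℝ) ^ (Fintype.card α - V.card) ≤
      (Fintype.card α - V.card).factorial * (univ.filter p).card := by exact_mod_cast h
  have h2 := factorial_sub_mul_pow_le _ _ hv
  calc ((univ.filter fun f : ι → α => Function.Bijective f ∧ p f).card : ℝ) *
        (Fintype.card α : ℝ) ^ Fintype.card α
      = (univ.filter fun f : ι → α => Function.Bijective f ∧ p f).card *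
        (Fintype.card α : ℝ) ^ (Fintype.card α - V.card) * (Fintype.card α : ℝ) ^ V.card := by
        rw [mul_assoc, ← pow_add, Nat.sub_add_cancel hv]
    _ ≤ (Fintype.card α - V.card).factorial * (univ.filter p).card *
        (Fintype.card α : ℝ) ^ V.card := by gcongr
    _ = ((Fintype.card α - V.card).factorial * (Fintype.card α : ℝ) ^ V.card) *
        (univ.filter p).card := by ring
    _ ≤ _ := by gcongr

/-- The positions whose value is `C`-close to the values at two earlier positions at distance at
most `q`. -/
def linActive {G : Type*} [AddCommGroup G] (q : ℕ) (C : Finset G) {m : ℕ} (f : Fin m → G) :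
    Finset (Fin m) :=
  univ.filter fun i => ∃ j₁ j₂ : Fin m, j₁ < j₂ ∧ j₂ < i ∧ i.val ≤ j₁.val + q ∧
    f i - f j₁ ∈ C ∧ f i - f j₂ ∈ C

theorem mem_linActive {G : Type*} [AddCommGroup G] {q : ℕ} {C : Finset G} {m : ℕ} {f : Fin m → G}
    {i : Fin m} : i ∈ linActive q C f ↔ ∃ j₁ j₂ : Fin m, j₁ < j₂ ∧ j₂ < i ∧
      i.val ≤ j₁.val + q ∧ f i - f j₁ ∈ C ∧ f i - f j₂ ∈ C := by
  simp only [linActive, mem_filter, mem_univ, true_and]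

theorem exists_compat {G : Type*} [AddCommGroup G] (q : ℕ) (C₁ C₂ : Finset G)
    (hC : ∀ x ∈ C₁, ∀ y ∈ C₁, x - y ∈ C₂) {m : ℕ} (f : Fin m → G) :
    ∃ ℓ : Fin m → Option Bool, Compat q C₁ C₂ ℓ f ∧
      (univ.filter fun i => ℓ i = some true) = linActive q C₁ f := by
  refine ⟨fun i => if i ∈ linActive q C₁ f then some true else
    if ∃ j < i, i.val ≤ j.val + q ∧ f i - f j ∈ C₂ then some false else none, ?_, ?_⟩
  · intro i
    by_cases hi : i ∈ linActive q C₁ f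
    · obtain ⟨j₁, j₂, h1, h2, h3, h4, h5⟩ := mem_linActive.1 hi
      simp only [hi, if_true, true_implies, Option.some.injEq, Bool.true_eq_false, false_implies,
        and_true]
      refine ⟨j₂, h2, by omega, ?_, h5⟩
      have : ∃ j < j₂, j₂.val ≤ j.val + q ∧ f j₂ - f j ∈ C₂ := by
        refine ⟨j₁, h1, by omega, ?_⟩
        simpa using hC _ h4 _ h5
      rw [if_pos this]
      split_ifs <;> simp
    · simp only [hi, if_false]
      constructor
      · split_ifs <;> simp
      · split_ifs with h
        · exact fun _ => h
        · simp
  · ext i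
    simp only [mem_filter, mem_univ, true_and]
    by_cases hi : i ∈ linActive q C₁ f
    · simp [hi]
    · simp only [hi, if_false, iff_false]
      split_ifs <;> simp

/-- The coordinates on which compatibility with the labelling `ℓ` depends. -/
def compatSupport (q : ℕ) {m : ℕ} (ℓ : Fin m → Option Bool) : Finset (Fin m) :=
  (univ.filter fun i => ℓ i = some true) ∪
    (univ.filter fun i => ℓ i = some false).biUnion fun i =>
      univ.filter fun j => j ≤ i ∧ i.val ≤ j.val + q

theorem card_compatSupport_le (q : ℕ) {m : ℕ} (ℓ : Fin m → Option Bool) :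
    (compatSupport q ℓ).card ≤ (univ.filter fun i => ℓ i = some true).card +
      (univ.filter fun i => ℓ i = some false).card * (q + 1) := by
  refine (Finset.card_union_le _ _).trans (Nat.add_le_add_left
    (Finset.card_biUnion_le_card_mul _ _ _ fun i _ => ?_) _)
  calc _ ≤ (Finset.Icc (i.val - q) i.val).card := by
        refine Finset.card_le_card_of_injOn (fun j => j.val) ?_ (fun x _ y _ h => Fin.ext h)
        intro j hj
        simp only [coe_filter, mem_univ, true_and, Set.mem_ofPred_eq] at hj
        simp only [coe_Icc, Set.mem_Icc]
        omega
    _ ≤ q + 1 := by rw [Nat.card_Icc]; omega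

theorem compat_congr {G : Type*} [AddCommGroup G] (q : ℕ) (C₁ C₂ : Finset G) {m : ℕ}
    (ℓ : Fin m → Option Bool) (f g : Fin m → G) (h : ∀ i ∈ compatSupport q ℓ, f i = g i)
    (hf : Compat q C₁ C₂ ℓ f) : Compat q C₁ C₂ ℓ g := by
  have hlab : ∀ i, ℓ i ≠ none → f i = g i := by
    intro i hi
    refine h i (mem_union.2 ?_)
    rcases hl : ℓ i with _ | _ | _
    · exact absurd hl hi
    · exact Or.inr (mem_biUnion.2 ⟨i, mem_filter.2 ⟨mem_univ _, hl⟩,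
        mem_filter.2 ⟨mem_univ _, le_rfl, by omega⟩⟩)
    · exact Or.inl (mem_filter.2 ⟨mem_univ _, hl⟩)
  intro i
  constructor
  · intro hi
    obtain ⟨j, h1, h2, h3, h4⟩ := (hf i).1 hi
    exact ⟨j, h1, h2, h3, by rwa [← hlab i (by simp [hi]), ← hlab j h3]⟩
  · intro hi
    obtain ⟨j, h1, h2, h4⟩ := (hf i).2 hi
    refine ⟨j, h1, h2, ?_⟩
    rwa [← hlab i (by simp [hi]), ← h j (mem_union_right _ (mem_biUnion.2
      ⟨i, mem_filter.2 ⟨mem_univ _, hi⟩, mem_filter.2 ⟨mem_univ _, h1.le, h2⟩⟩))]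

theorem prod_labelWeight {m : ℕ} (a b : ℝ) (ℓ : Fin m → Option Bool) :
    ∏ i, labelWeight a b (ℓ i) = a ^ (univ.filter fun i => ℓ i = some true).card *
      b ^ (univ.filter fun i => ℓ i = some false).card := by
  rw [← Finset.prod_const, ← Finset.prod_const, Finset.prod_filter, Finset.prod_filter,
    ← Finset.prod_mul_distrib]
  refine Finset.prod_congr rfl fun i _ => ?_
  rcases ℓ i with _ | _ | _ <;> simp [labelWeight]

theorem sum_bijective_pow_linActive_le {G : Type*} [AddCommGroup G] [Fintype G] [DecidableEq G]
    (q n : ℕ)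
    (hn : Fintype.card G = n) (C₁ C₂ : Finset G) (hC : ∀ x ∈ C₁, ∀ y ∈ C₁, x - y ∈ C₂)
    {X : ℝ} (hX : 0 ≤ X)
    (hab : X * Real.exp 1 * C₁.card * (1 + q + (q : ℝ) ^ 2) ≤ n) :
    ∑ f ∈ univ.filter (fun f : Fin n → G => Function.Bijective f),
        X ^ (linActive q C₁ f).card ≤
      n.factorial * Real.exp (Real.exp 1 ^ (q + 1) * (q * C₂.card) * (1 + q)) := by
  have hn0 : 0 < n := hn ▸ Fintype.card_pos
  have hn' : (0 : ℝ) < n := by exact_mod_cast hn0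
  set b := Real.exp 1 ^ (q + 1) with hb
  set a := X * Real.exp 1 with ha
  have ha0 : 0 ≤ a := by positivity
  have hb0 : 0 ≤ b := by positivity
  set K := b * (q * C₂.card) * (1 + q) with hK
  have key : (∑ f ∈ univ.filter (fun f : Fin n → G => Function.Bijective f),
      X ^ (linActive q C₁ f).card) * (n : ℝ) ^ n ≤ n.factorial * (n + K) ^ n := by
    have h1 : ∑ f ∈ univ.filter (fun f : Fin n → G => Function.Bijective f),
        X ^ (linActive q C₁ f).card ≤
        ∑ f ∈ univ.filter (fun f : Fin n → G => Function.Bijective f),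
          ∑ ℓ : Fin n → Option Bool, (if Compat q C₁ C₂ ℓ f then
            X ^ (univ.filter fun i => ℓ i = some true).card else 0) := by
      refine Finset.sum_le_sum fun f _ => ?_
      obtain ⟨ℓ, h1, h2⟩ := exists_compat q C₁ C₂ hC f
      refine le_trans (le_of_eq ?_) (Finset.single_le_sum (fun ℓ _ => ?_) (mem_univ ℓ))
      · rw [if_pos h1, h2]
      · split_ifs <;> positivity
    have h2 : ∀ ℓ : Fin n → Option Bool,
        (∑ f ∈ univ.filter (fun f : Fin n → G => Function.Bijective f),
          (if Compat q C₁ C₂ ℓ f then X ^ (univ.filter fun i => ℓ i = some true).card else 0)) *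
          (n : ℝ) ^ n ≤
        n.factorial * ((∏ i, labelWeight a b (ℓ i)) *
          ((univ.filter fun f : Fin n → G => Compat q C₁ C₂ ℓ f).card : ℝ)) := by
      intro ℓ
      have h3 := card_bijective_le_exp (ι := Fin n) (α := G) (by simp [hn]) (compatSupport q ℓ)
        (Compat q C₁ C₂ ℓ) (fun f g => compat_congr q C₁ C₂ ℓ f g)
      rw [hn] at h3
      have h4 : Real.exp 1 ^ (compatSupport q ℓ).card ≤
          Real.exp 1 ^ (univ.filter fun i => ℓ i = some true).card *
            b ^ (univ.filter fun i => ℓ i = some false).card := by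
        rw [hb, ← pow_mul, ← pow_add, mul_comm (q + 1)]
        exact pow_le_pow_right₀ (Real.one_le_exp zero_le_one) (card_compatSupport_le q ℓ)
      rw [← Finset.sum_filter, Finset.filter_filter, Finset.sum_const, nsmul_eq_mul,
        prod_labelWeight, ha, mul_pow]
      set t := (univ.filter fun i => ℓ i = some true).card
      set u := (univ.filter fun i => ℓ i = some false).card
      set c := ((univ.filter fun f : Fin n → G => Compat q C₁ C₂ ℓ f).card : ℝ)
      calc _ = X ^ t * (((univ.filter fun f : Fin n → G =>
              Function.Bijective f ∧ Compat q C₁ C₂ ℓ f).card : ℝ) * (n : ℝ) ^ n) := by ring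
        _ ≤ X ^ t * (Real.exp 1 ^ (compatSupport q ℓ).card * n.factorial * c) :=
          mul_le_mul_of_nonneg_left h3 (by positivity)
        _ ≤ X ^ t * (Real.exp 1 ^ t * b ^ u * n.factorial * c) := by gcongr
        _ = _ := by ring
    calc _ ≤ (∑ f ∈ univ.filter (fun f : Fin n → G => Function.Bijective f),
          ∑ ℓ : Fin n → Option Bool, (if Compat q C₁ C₂ ℓ f then
            X ^ (univ.filter fun i => ℓ i = some true).card else 0)) * (n : ℝ) ^ n := by gcongr
      _ ≤ ∑ ℓ : Fin n → Option Bool, n.factorial * ((∏ i, labelWeight a b (ℓ i)) *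
          ((univ.filter fun f : Fin n → G => Compat q C₁ C₂ ℓ f).card : ℝ)) := by
        rw [Finset.sum_comm, Finset.sum_mul]
        exact Finset.sum_le_sum fun ℓ _ => h2 ℓ
      _ ≤ n.factorial * (n + K) ^ n := by
        rw [← Finset.mul_sum]
        have := sum_weight_card_compat_le q C₁ C₂ ha0 hb0 (by rw [hn]; exact hab) n
        rw [hn] at this
        gcongr
  have hpow : ((n : ℝ) + K) ^ n ≤ Real.exp K * (n : ℝ) ^ n := by
    have : (n : ℝ) + K ≤ Real.exp (K / n) * n := by
      have := Real.add_one_le_exp (K / n)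
      calc (n : ℝ) + K = (K / n + 1) * n := by field_simp; ring
        _ ≤ _ := by gcongr
    calc ((n : ℝ) + K) ^ n ≤ (Real.exp (K / n) * n) ^ n :=
          pow_le_pow_left₀ (by positivity) this n
      _ = _ := by
          rw [mul_pow, ← Real.exp_nat_mul, mul_div_cancel₀ _ hn'.ne']
  have hnn : (0 : ℝ) < (n : ℝ) ^ n := by positivity
  refine le_of_mul_le_mul_right (key.trans ?_) hnn
  rw [mul_assoc]
  gcongr

/-- The residues within cyclic distance `d` of `0`. -/
def nearSet (n d : ℕ) : Finset (ZMod n) :=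
  (Finset.Icc (-(d : ℤ)) (d : ℤ)).image fun x : ℤ => (x : ZMod n)

theorem card_nearSet_le (n d : ℕ) : (nearSet n d).card ≤ 2 * d + 1 := by
  refine Finset.card_image_le.trans ?_
  rw [Int.card_Icc]
  omega

theorem neg_mem_nearSet {n d : ℕ} {x : ZMod n} (hx : x ∈ nearSet n d) : -x ∈ nearSet n d := by
  obtain ⟨y, hy, rfl⟩ := mem_image.1 hx
  rw [mem_Icc] at hy
  exact mem_image.2 ⟨-y, mem_Icc.2 (by omega), by push_cast; rfl⟩

theorem neg_mem_nearSet_iff {n d : ℕ} {x : ZMod n} : -x ∈ nearSet n d ↔ x ∈ nearSet n d :=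
  ⟨fun h => by simpa using neg_mem_nearSet h, neg_mem_nearSet⟩

theorem sub_mem_nearSet {n d : ℕ} {x y : ZMod n} (hx : x ∈ nearSet n d) (hy : y ∈ nearSet n d) :
    x - y ∈ nearSet n (2 * d) := by
  obtain ⟨a, ha, rfl⟩ := mem_image.1 hx
  obtain ⟨b, hb, rfl⟩ := mem_image.1 hy
  rw [mem_Icc] at ha hb
  exact mem_image.2 ⟨a - b, mem_Icc.2 (by push_cast; omega), by push_cast; rfl⟩

/-- The positions `u` whose value under `π` is at distance at most `q` from the values at two of
the `q` cyclically preceding positions. -/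
def cycActive (q n : ℕ) [NeZero n] (π : ZMod n → ZMod n) : Finset (ZMod n) :=
  univ.filter fun u => ∃ d₂ d₁ : ℕ, 0 < d₂ ∧ d₂ < d₁ ∧ d₁ ≤ q ∧
    π u - π (u - d₁) ∈ nearSet n q ∧ π u - π (u - d₂) ∈ nearSet n q

theorem cycActive_neg (q n : ℕ) [NeZero n] (π : ZMod n → ZMod n) :
    cycActive q n (fun x => -π x) = cycActive q n π := by
  unfold cycActive
  have h : ∀ x y : ZMod n, -x - -y = -(x - y) := fun x y => by ring
  simp only [h, neg_mem_nearSet_iff]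

theorem cycActive_add (q n : ℕ) [NeZero n] (π : ZMod n → ZMod n) (c : ZMod n) :
    cycActive q n (fun x => π x + c) = cycActive q n π := by
  unfold cycActive
  simp only [add_sub_add_right_eq_sub]

theorem card_filter_cycActive_le (q n : ℕ) [NeZero n] (π : ZMod n → ZMod n) (c : ZMod n) :
    ((cycActive q n π).filter fun u => q ≤ (u - c).val).card ≤
      (linActive q (nearSet n q) fun i : Fin n => π (c + (i.val : ZMod n))).card := by
  refine Finset.card_le_card_of_injOn (fun u => (⟨(u - c).val, ZMod.val_lt _⟩ : Fin n)) ?_ ?_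
  · intro u hu
    obtain ⟨hu, huq⟩ := mem_filter.1 hu
    obtain ⟨d₂, d₁, h1, h2, h3, h4, h5⟩ := (mem_filter.1 hu).2
    have hlt := ZMod.val_lt (u - c)
    have hpos : ∀ d : ℕ, d ≤ q → c + (((u - c).val - d : ℕ) : ZMod n) = u - d := by
      intro d hd
      rw [Nat.cast_sub (hd.trans huq), ZMod.natCast_zmod_val]
      ring
    have hself : c + (((u - c).val : ℕ) : ZMod n) = u := by
      rw [ZMod.natCast_zmod_val]; ring
    have hv : ∀ d : ℕ, (u - c).val - d < n := fun d => (Nat.sub_le _ _).trans_lt hlt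
    obtain ⟨j₁, hj₁⟩ : ∃ j : Fin n, j.val = (u - c).val - d₁ := ⟨⟨_, hv d₁⟩, rfl⟩
    obtain ⟨j₂, hj₂⟩ : ∃ j : Fin n, j.val = (u - c).val - d₂ := ⟨⟨_, hv d₂⟩, rfl⟩
    refine mem_coe.2 (mem_linActive.2 ⟨j₁, j₂, ?_, ?_, ?_, ?_, ?_⟩)
    · rw [Fin.lt_def, hj₁, hj₂]
      exact Nat.sub_lt_sub_left (h2.trans_le (h3.trans huq)) h2
    · rw [Fin.lt_def, hj₂]
      exact Nat.sub_lt (h1.trans (h2.trans_le (h3.trans huq))) h1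
    · rw [hj₁]
      exact tsub_le_iff_right.1 (Nat.sub_le_sub_left h3 _)
    · rw [hj₁, hself, hpos d₁ h3]; exact h4
    · rw [hj₂, hself, hpos d₂ (h2.le.trans h3)]; exact h5
  · intro u _ v _ h
    have h' : (u - c).val = (v - c).val := congrArg Fin.val h
    exact sub_left_injective (ZMod.val_injective n h')

theorem card_filter_val_sub_lt (q n : ℕ) [NeZero n] (c : ZMod n) :
    (univ.filter fun u : ZMod n => (u - c).val < q).card ≤ q := by
  calc _ ≤ (Finset.range q).card := by
        refine Finset.card_le_card_of_injOn (fun u => (u - c).val) ?_ ?_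
        · intro u hu
          exact mem_coe.2 (mem_range.2 (mem_filter.1 hu).2)
        · intro u _ v _ h
          exact sub_left_injective (ZMod.val_injective n h)
    _ = q := card_range q

theorem card_filter_val_const_sub_lt (q n : ℕ) [NeZero n] (u : ZMod n) :
    (univ.filter fun c : ZMod n => (u - c).val < q).card ≤ q := by
  calc _ ≤ (Finset.range q).card := by
        refine Finset.card_le_card_of_injOn (fun c => (u - c).val) ?_ ?_
        · intro c hc
          exact mem_coe.2 (mem_range.2 (mem_filter.1 hc).2)
        · intro c _ d _ h
          exact sub_right_injective (ZMod.val_injective n h)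
    _ = q := card_range q

theorem card_cycActive_le_linActive_add (q n : ℕ) [NeZero n] (π : ZMod n → ZMod n) (c : ZMod n) :
    (cycActive q n π).card ≤
      (linActive q (nearSet n q) fun i : Fin n => π (c + (i.val : ZMod n))).card + q := by
  rw [← Finset.card_filter_add_card_filter_not (s := cycActive q n π) fun u => q ≤ (u - c).val]
  refine Nat.add_le_add (card_filter_cycActive_le q n π c) ((Finset.card_le_card ?_).trans
    (card_filter_val_sub_lt q n c))
  intro u hu
  exact mem_filter.2 ⟨mem_univ _, not_le.1 (mem_filter.1 hu).2⟩

/-- Averaging over the starting point reduces the cyclic count to the linear one. -/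
theorem pow_card_cycActive_le (q n : ℕ) [NeZero n] {x : ℝ} (hx : 1 ≤ x)
    (hlarge : ∀ t : ℕ, n < 2 * (q * t) → (2 * x) ^ q ≤ 2 ^ t) (π : ZMod n → ZMod n) :
    n * x ^ (cycActive q n π).card ≤ 2 * ∑ c : ZMod n,
      (2 * x) ^ (linActive q (nearSet n q) fun i : Fin n => π (c + (i.val : ZMod n))).card := by
  set t := (cycActive q n π).card with ht
  set s : ZMod n → ℕ := fun c =>
    (linActive q (nearSet n q) fun i : Fin n => π (c + (i.val : ZMod n))).card with hs
  change n * x ^ t ≤ 2 * ∑ c, (2 * x) ^ s c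
  rcases lt_or_ge n (2 * (q * t)) with h | h
  · have h1 : ∀ c, x ^ t ≤ (2 * x) ^ s c := by
      intro c
      have h2 : t ≤ s c + q := card_cycActive_le_linActive_add q n π c
      have h3 := hlarge t h
      have h4 : (2 * x) ^ t ≤ (2 * x) ^ s c * (2 * x) ^ q := by
        rw [← pow_add]
        exact pow_le_pow_right₀ (by linarith) h2
      have h5 : (2 * x) ^ s c * (2 * x) ^ q ≤ (2 * x) ^ s c * 2 ^ t := by gcongr
      have h6 := h4.trans h5
      rw [mul_pow 2 x t, mul_comm] at h6
      exact le_of_mul_le_mul_right h6 (by positivity)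
    have h2 := Finset.sum_le_sum fun c (_ : c ∈ (univ : Finset (ZMod n))) => h1 c
    rw [Finset.sum_const, card_univ, ZMod.card, nsmul_eq_mul] at h2
    have : 0 ≤ ∑ c, (2 * x) ^ s c := Finset.sum_nonneg fun c _ => by positivity
    linarith
  · set bad := (cycActive q n π).biUnion fun u => univ.filter fun c : ZMod n => (u - c).val < q
      with hbad
    have hb : bad.card ≤ t * q :=
      Finset.card_biUnion_le_card_mul _ _ _ fun u _ => card_filter_val_const_sub_lt q n u
    have h1 : ∀ c ∈ badᶜ, x ^ t ≤ (2 * x) ^ s c := by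
      intro c hc
      have h2 : t ≤ s c := by
        refine le_trans (le_of_eq ?_) (card_filter_cycActive_le q n π c)
        rw [Finset.filter_true_of_mem]
        intro u hu
        by_contra hlt
        exact (mem_compl.1 hc) (mem_biUnion.2 ⟨u, hu, mem_filter.2 ⟨mem_univ _, not_le.1 hlt⟩⟩)
      calc x ^ t ≤ x ^ s c := pow_le_pow_right₀ hx h2
        _ ≤ _ := by gcongr; linarith
    have h2 := Finset.sum_le_sum h1
    rw [Finset.sum_const, card_compl, ZMod.card, nsmul_eq_mul] at h2
    have h3 : ∑ c ∈ badᶜ, (2 * x) ^ s c ≤ ∑ c, (2 * x) ^ s c :=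
      Finset.sum_le_sum_of_subset_of_nonneg (subset_univ _) fun c _ _ => by positivity
    have h4 : (n : ℝ) ≤ 2 * (n - bad.card : ℕ) := by
      have : n ≤ 2 * (n - bad.card) := by
        have : t * q = q * t := mul_comm _ _
        omega
      exact_mod_cast this
    calc n * x ^ t ≤ (2 * (n - bad.card : ℕ)) * x ^ t := by gcongr
      _ ≤ _ := by linarith

theorem sum_perm_pow_cycActive_le (q n : ℕ) [NeZero n] {x : ℝ} (hx : 1 ≤ x)
    (hlarge : ∀ t : ℕ, n < 2 * (q * t) → (2 * x) ^ q ≤ 2 ^ t)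
    (hab : 2 * x * Real.exp 1 * (2 * q + 1) * (1 + q + (q : ℝ) ^ 2) ≤ n) :
    ∑ π : Equiv.Perm (ZMod n), x ^ (cycActive q n π).card ≤
      2 * (n.factorial * Real.exp (Real.exp 1 ^ (q + 1) * (q * (4 * q + 1)) * (1 + q))) := by
  have hn : (0 : ℝ) < n := by exact_mod_cast NeZero.pos n
  have hc1 : ((nearSet n q).card : ℝ) ≤ 2 * q + 1 := by exact_mod_cast card_nearSet_le n q
  have hc2 : ((nearSet n (2 * q)).card : ℝ) ≤ 4 * q + 1 := by
    have := card_nearSet_le n (2 * q)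
    have : (nearSet n (2 * q)).card ≤ 4 * q + 1 := by omega
    exact_mod_cast this
  have hlin := sum_bijective_pow_linActive_le (G := ZMod n) q n (ZMod.card n) (nearSet n q)
    (nearSet n (2 * q)) (fun x hx y hy => sub_mem_nearSet hx hy) (X := 2 * x) (by linarith)
    (le_trans (by gcongr) hab)
  have hlin' : ∀ c : ZMod n, ∑ π : Equiv.Perm (ZMod n),
      (2 * x) ^ (linActive q (nearSet n q) fun i : Fin n => π (c + (i.val : ZMod n))).card ≤
      n.factorial * Real.exp (Real.exp 1 ^ (q + 1) * (q * (4 * q + 1)) * (1 + q)) := by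
    intro c
    have hcast : Function.Bijective fun i : Fin n => c + (i.val : ZMod n) := by
      rw [Fintype.bijective_iff_injective_and_card]
      refine ⟨fun i j hij => Fin.ext ?_, by simp⟩
      have := congrArg ZMod.val (add_left_cancel hij)
      rwa [ZMod.val_natCast_of_lt i.2, ZMod.val_natCast_of_lt j.2] at this
    refine le_trans ?_ (hlin.trans (by gcongr))
    rw [← Finset.sum_image (s := univ) (g := fun (π : Equiv.Perm (ZMod n)) (i : Fin n) =>
      π (c + (i.val : ZMod n)))
      (f := fun f : Fin n → ZMod n => (2 * x) ^ (linActive q (nearSet n q) f).card)]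
    · refine Finset.sum_le_sum_of_subset_of_nonneg ?_ fun f _ _ => by positivity
      intro f hf
      obtain ⟨π, -, rfl⟩ := mem_image.1 hf
      exact mem_filter.2 ⟨mem_univ _, π.bijective.comp hcast⟩
    · intro π _ π' _ h
      ext1 y
      obtain ⟨i, rfl⟩ := hcast.2 y
      exact congrFun h i
  have h1 : n * ∑ π : Equiv.Perm (ZMod n), x ^ (cycActive q n π).card ≤
      2 * ∑ c : ZMod n, ∑ π : Equiv.Perm (ZMod n),
        (2 * x) ^ (linActive q (nearSet n q) fun i : Fin n => π (c + (i.val : ZMod n))).card := by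
    rw [Finset.sum_comm, Finset.mul_sum, Finset.mul_sum]
    exact Finset.sum_le_sum fun π _ => pow_card_cycActive_le q n hx hlarge π
  have h2 := Finset.sum_le_sum fun c (_ : c ∈ (univ : Finset (ZMod n))) => hlin' c
  rw [Finset.sum_const, card_univ, ZMod.card, nsmul_eq_mul] at h2
  refine le_of_mul_le_mul_left ?_ hn
  linarith

/-- A canonical cyclic ordering as an equivalence. -/
def IsCycRep.equiv {n : ℕ} {τ : ZMod n → Fin n} (h : IsCycRep n τ) : ZMod n ≃ Fin n :=
  Equiv.ofBijective τ h.1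

/-- The permutation comparing `σ` with a rotated and possibly reflected copy of the cyclic
ordering `τ`. -/
def repPerm {n : ℕ} (σ : ZMod n ≃ Fin n) (x : {τ // IsCycRep n τ} × ZMod n × Bool) :
    Equiv.Perm (ZMod n) :=
  σ.trans (x.1.2.equiv.symm.trans
    ((if x.2.2 then Equiv.neg (ZMod n) else Equiv.refl (ZMod n)).trans (Equiv.addRight x.2.1)))

theorem repPerm_apply {n : ℕ} (σ : ZMod n ≃ Fin n) (τ : {τ // IsCycRep n τ}) (c : ZMod n)
    (s : Bool) (y : ZMod n) : repPerm σ (τ, c, s) y =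
      (if s then -(τ.2.equiv.symm (σ y)) else τ.2.equiv.symm (σ y)) + c := by
  cases s <;> simp [repPerm]

theorem repPerm_injective {n : ℕ} (σ : ZMod n ≃ Fin n) : Function.Injective (repPerm σ) := by
  rintro ⟨τ, c, s⟩ ⟨τ', c', s'⟩ h
  have h1 : ∀ z : Fin n, (if s then -(τ.2.equiv.symm z) else τ.2.equiv.symm z) + c =
      (if s' then -(τ'.2.equiv.symm z) else τ'.2.equiv.symm z) + c' := by
    intro z
    have := DFunLike.congr_fun h (σ.symm z)
    simpa only [repPerm_apply, Equiv.apply_symm_apply] using this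
  have h0 : τ.2.equiv.symm (τ.1 0) = 0 := τ.2.equiv.symm_apply_apply 0
  have h0' : τ'.2.equiv.symm (τ.1 0) = 0 := by
    have : τ.1 0 = τ'.1 0 := Fin.ext (τ.2.2.1.trans τ'.2.2.1.symm)
    rw [this]
    exact τ'.2.equiv.symm_apply_apply 0
  obtain rfl : c = c' := by
    have := h1 (τ.1 0)
    rw [h0, h0'] at this
    simpa using this
  have h2 : ∀ z : Fin n, (if s then -(τ.2.equiv.symm z) else τ.2.equiv.symm z) =
      (if s' then -(τ'.2.equiv.symm z) else τ'.2.equiv.symm z) :=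
    fun z => add_right_cancel (h1 z)
  have hopp : (∀ z : Fin n, τ'.2.equiv.symm z = -(τ.2.equiv.symm z)) → False := by
    intro hz
    have h3 : ∀ y, τ'.1 (-y) = τ.1 y := by
      intro y
      have := hz (τ.1 y)
      rw [show τ.2.equiv.symm (τ.1 y) = y from τ.2.equiv.symm_apply_apply y] at this
      exact (τ'.2.equiv.symm_apply_eq.1 this).symm
    have h4 := τ.2.2.2
    have h5 := τ'.2.2.2
    rw [← h3 1, ← h3 (-1), neg_neg] at h4
    omega
  have hsame : (∀ z : Fin n, τ.2.equiv.symm z = τ'.2.equiv.symm z) → τ = τ' := by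
    intro hz
    refine Subtype.ext (funext fun y => ?_)
    have := hz (τ.1 y)
    rw [show τ.2.equiv.symm (τ.1 y) = y from τ.2.equiv.symm_apply_apply y] at this
    exact τ'.2.equiv.symm_apply_eq.1 this.symm
  cases s <;> cases s' <;> simp only [if_true, if_false, Bool.false_eq_true] at h2
  · rw [hsame h2]
  · exact (hopp fun z => by rw [h2 z, neg_neg]).elim
  · exact (hopp fun z => (h2 z).symm).elim
  · rw [hsame fun z => neg_injective (h2 z)]

theorem repPerm_surjective {n : ℕ} (hn : 3 ≤ n) (σ : ZMod n ≃ Fin n) :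
    Function.Surjective (repPerm σ) := by
  intro π
  set ρ : Fin n ≃ ZMod n := σ.symm.trans π with hρ
  set c := ρ ⟨0, by omega⟩ with hc
  have hπ : ∀ y, π y = ρ (σ y) := fun y => by simp [hρ]
  set τ₀ : ZMod n ≃ Fin n := (Equiv.addRight c).trans ρ.symm with hτ₀
  have h0 : (τ₀ 0).val = 0 := by simp [hτ₀, hc]
  have hsymm : ∀ z, τ₀.symm z + c = ρ z := fun z => by simp [hτ₀]
  have hne : (τ₀ 1).val ≠ (τ₀ (-1)).val := by
    intro h
    have h1 : (1 : ZMod n) = -1 := τ₀.injective (Fin.ext h)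
    have h2 : ((2 : ℕ) : ZMod n) = 0 := by
      push_cast
      linear_combination h1
    rw [ZMod.natCast_eq_zero_iff] at h2
    have := Nat.le_of_dvd (by norm_num) h2
    omega
  rcases lt_or_gt_of_ne hne with h | h
  · have hrep : IsCycRep n τ₀ := ⟨τ₀.bijective, h0, h⟩
    refine ⟨(⟨τ₀, hrep⟩, c, false), Equiv.ext fun y => ?_⟩
    rw [repPerm_apply, hπ, ← hsymm]
    simp only [Bool.false_eq_true, if_false]
    congr 1
    rw [Equiv.symm_apply_eq]
    exact (τ₀.apply_symm_apply _).symm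
  · have hrep : IsCycRep n ((Equiv.neg (ZMod n)).trans τ₀) :=
      ⟨((Equiv.neg (ZMod n)).trans τ₀).bijective, by simpa using h0, by simpa using h⟩
    refine ⟨(⟨_, hrep⟩, c, true), Equiv.ext fun y => ?_⟩
    rw [repPerm_apply, hπ, ← hsymm]
    simp only [if_true]
    congr 1
    rw [neg_eq_iff_eq_neg, Equiv.symm_apply_eq]
    simp [IsCycRep.equiv]

theorem sum_perm_eq_sum_cycRep {n : ℕ} [NeZero n] (hn : 3 ≤ n) (σ : ZMod n ≃ Fin n)
    (F : Finset (ZMod n) → ℝ) (q : ℕ) :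
    ∑ π : Equiv.Perm (ZMod n), F (cycActive q n π) = 2 * n *
      ∑ τ : {τ // IsCycRep n τ}, F (cycActive q n fun y => τ.2.equiv.symm (σ y)) := by
  have hbij : Function.Bijective (repPerm σ) := ⟨repPerm_injective σ, repPerm_surjective hn σ⟩
  rw [← (Equiv.ofBijective _ hbij).sum_comp, Fintype.sum_prod_type, Finset.mul_sum]
  refine Finset.sum_congr rfl fun τ _ => ?_
  have h : ∀ x : ZMod n × Bool, cycActive q n (repPerm σ (τ, x)) =
      cycActive q n fun y => τ.2.equiv.symm (σ y) := by
    rintro ⟨c, s⟩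
    have : ⇑(repPerm σ (τ, c, s)) = fun y =>
        (if s then -(τ.2.equiv.symm (σ y)) else τ.2.equiv.symm (σ y)) + c :=
      funext fun y => repPerm_apply σ τ c s y
    rw [this, cycActive_add q n fun y =>
      if s then -(τ.2.equiv.symm (σ y)) else τ.2.equiv.symm (σ y)]
    cases s
    · simp
    · simpa using cycActive_neg q n fun y => τ.2.equiv.symm (σ y)
  simp only [Equiv.ofBijective_apply, h, Finset.sum_const, card_univ, Fintype.card_prod,
    ZMod.card, Fintype.card_bool, nsmul_eq_mul]
  push_cast
  ring

theorem factorial_eq_mul_QCard {n : ℕ} [NeZero n] (hn : 3 ≤ n) (σ : ZMod n ≃ Fin n) :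
    (n.factorial : ℝ) = 2 * n * QCard n := by
  have := sum_perm_eq_sum_cycRep hn σ (fun _ => 1) 0
  simpa [QCard, Nat.card_eq_fintype_card, Fintype.card_perm, ZMod.card] using this

theorem mem_cycWindow {k r n : ℕ} {σ : ZMod n → Fin n} {i : ZMod n} {v : Fin n} :
    v ∈ cycWindow k r n σ i ↔ ∃ j < k + r - 1, σ (i + (j : ZMod n)) = v := by
  simp [cycWindow]

theorem mem_hamPowEdges {k r n : ℕ} {σ : ZMod n → Fin n} {e : Finset (Fin n)} :
    e ∈ hamPowEdges r k n σ ↔ e.card = r ∧ ∃ i, e ⊆ cycWindow k r n σ i := by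
  simp [hamPowEdges]

theorem mem_cycActive {q n : ℕ} [NeZero n] {π : ZMod n → ZMod n} {u : ZMod n} :
    u ∈ cycActive q n π ↔ ∃ d₂ d₁ : ℕ, 0 < d₂ ∧ d₂ < d₁ ∧ d₁ ≤ q ∧
      π u - π (u - d₁) ∈ nearSet n q ∧ π u - π (u - d₂) ∈ nearSet n q := by
  simp [cycActive]

/-- Every shared edge is an `r`-set whose last vertex in `σ` sits at an active position. -/
theorem card_inter_hamPowEdges_le {r k n : ℕ} [NeZero n] (hr : 3 ≤ r) (σ τ : ZMod n ≃ Fin n) :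
    (hamPowEdges r k n σ ∩ hamPowEdges r k n τ).card ≤
      (k + r - 2).choose (r - 1) * (cycActive (k + r - 2) n fun y => τ.symm (σ y)).card := by
  set q := k + r - 2 with hq
  set W : ZMod n → Finset (Fin n) := fun u =>
    (Finset.Icc 1 q).image fun d : ℕ => σ (u - (d : ZMod n)) with hW
  have hWcard : ∀ u, (W u).card ≤ q := fun u => Finset.card_image_le.trans (by simp)
  have hsub : hamPowEdges r k n σ ∩ hamPowEdges r k n τ ⊆
      (cycActive q n fun y => τ.symm (σ y)).biUnion fun u =>
        (Finset.powersetCard (r - 1) (W u)).image fun e => insert (σ u) e := by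
    intro e he
    obtain ⟨he₁, he₂⟩ := mem_inter.1 he
    obtain ⟨hcard, i, hi⟩ := mem_hamPowEdges.1 he₁
    obtain ⟨-, i', hi'⟩ := mem_hamPowEdges.1 he₂
    have hw : k + r - 1 = q + 1 := by omega
    set J := (Finset.range (q + 1)).filter fun j : ℕ => σ (i + (j : ZMod n)) ∈ e with hJ
    have hJne : J.Nonempty := by
      obtain ⟨v, hv⟩ := Finset.card_pos.1 (by omega : 0 < e.card)
      obtain ⟨j, hj, rfl⟩ := mem_cycWindow.1 (hi hv)
      exact ⟨j, mem_filter.2 ⟨mem_range.2 (hw ▸ hj), hv⟩⟩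
    obtain ⟨j₀, hj₀, hmax⟩ := Finset.exists_max_image J id hJne
    obtain ⟨hj₀q, hj₀e⟩ := mem_filter.1 hj₀
    set u := i + (j₀ : ZMod n) with hu
    have herase : e.erase (σ u) ⊆ W u := by
      intro v hv
      obtain ⟨hvne, hve⟩ := mem_erase.1 hv
      obtain ⟨j, hj, rfl⟩ := mem_cycWindow.1 (hi hve)
      have hjle : j ≤ j₀ := hmax j (mem_filter.2 ⟨mem_range.2 (hw ▸ hj), hve⟩)
      have hjne : j ≠ j₀ := by
        rintro rfl
        exact hvne rfl
      rw [mem_range] at hj₀q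
      refine mem_image.2 ⟨j₀ - j, mem_Icc.2 (by omega), congrArg σ ?_⟩
      rw [Nat.cast_sub hjle, hu]
      ring
    have hecard : (e.erase (σ u)).card = r - 1 := by rw [card_erase_of_mem hj₀e, hcard]
    have hnear : ∀ v ∈ e, ∀ w ∈ e, τ.symm v - τ.symm w ∈ nearSet n q := by
      intro v hv w hw'
      obtain ⟨a, ha, rfl⟩ := mem_cycWindow.1 (hi' hv)
      obtain ⟨b, hb, rfl⟩ := mem_cycWindow.1 (hi' hw')
      rw [Equiv.symm_apply_apply, Equiv.symm_apply_apply]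
      refine mem_image.2 ⟨(a : ℤ) - b, mem_Icc.2 (by omega), ?_⟩
      push_cast
      ring
    refine mem_biUnion.2 ⟨u, ?_, mem_image.2 ⟨e.erase (σ u),
      mem_powersetCard.2 ⟨herase, hecard⟩, insert_erase hj₀e⟩⟩
    obtain ⟨v, hv, w, hw, hvw⟩ := Finset.one_lt_card.1 (by omega : 1 < (e.erase (σ u)).card)
    obtain ⟨d, hd, hdv⟩ := mem_image.1 (herase hv)
    obtain ⟨d', hd', hdw⟩ := mem_image.1 (herase hw)
    have hv' := hnear _ hj₀e _ (mem_of_mem_erase hv)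
    have hw' := hnear _ hj₀e _ (mem_of_mem_erase hw)
    rw [← hdv] at hv'
    rw [← hdw] at hw'
    rw [mem_Icc] at hd hd'
    have hdd : d ≠ d' := by
      rintro rfl
      exact hvw (hdv.symm.trans hdw)
    rw [mem_cycActive]
    rcases lt_or_gt_of_ne hdd with h | h
    · exact ⟨d, d', by omega, h, by omega, hw', hv'⟩
    · exact ⟨d', d, by omega, h, by omega, hv', hw'⟩
  refine (Finset.card_le_card hsub).trans ((Finset.card_biUnion_le_card_mul _ _
    (q.choose (r - 1)) fun u _ => ?_).trans (le_of_eq (mul_comm _ _)))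
  refine Finset.card_image_le.trans ?_
  rw [card_powersetCard]
  exact Nat.choose_le_choose _ (hWcard u)

theorem NQ_eq_card_filter (r k n : ℕ) [NeZero n] (σ : ZMod n → Fin n) (b : ℕ) :
    NQ r k n σ b = (univ.filter fun τ : {τ // IsCycRep n τ} =>
      (hamPowEdges r k n σ ∩ hamPowEdges r k n τ.1).card = b).card := by
  rw [NQ, ← Fintype.card_subtype, ← Nat.card_eq_fintype_card]
  exact Nat.card_congr (Equiv.subtypeSubtypeEquivSubtypeInter _ _).symm

theorem sum_NQ_mul_pow_le (r k n : ℕ) [NeZero n] (σ : ZMod n → Fin n) {y : ℝ} (hy : 0 ≤ y)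
    (S : Finset ℕ) : ∑ b ∈ S, (NQ r k n σ b : ℝ) * y ^ b ≤
      ∑ τ : {τ // IsCycRep n τ}, y ^ (hamPowEdges r k n σ ∩ hamPowEdges r k n τ.1).card := by
  refine le_trans (le_of_eq (Finset.sum_congr rfl fun b _ => ?_))
    (Finset.sum_fiberwise_le_sum_of_sum_fiber_nonneg (s := univ) (t := S)
      (g := fun τ : {τ // IsCycRep n τ} => (hamPowEdges r k n σ ∩ hamPowEdges r k n τ.1).card)
      (f := fun τ => y ^ (hamPowEdges r k n σ ∩ hamPowEdges r k n τ.1).card)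
      fun b _ => Finset.sum_nonneg fun τ _ => pow_nonneg hy _)
  rw [NQ_eq_card_filter, ← nsmul_eq_mul, ← Finset.sum_const]
  refine Finset.sum_congr rfl fun τ hτ => ?_
  rw [(mem_filter.1 hτ).2]

theorem le_choose_add_sub_two {r k : ℕ} (hr : 2 ≤ r) : k ≤ (k + r - 2).choose (r - 1) := by
  obtain ⟨s, rfl⟩ := Nat.exists_eq_add_of_le hr
  rw [show k + (2 + s) - 2 = k + s by omega, show 2 + s - 1 = s + 1 by omega]
  induction k with
  | zero => exact Nat.zero_le _
  | succ k ih =>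
    rw [show k + 1 + s = k + s + 1 by ring, Nat.choose_succ_succ']
    have : 0 < (k + s).choose s := Nat.choose_pos (Nat.le_add_left _ _)
    omega

theorem two_mul_le_pow_choose {r k : ℕ} (hr : 3 ≤ r) (hk : 1 ≤ k) :
    2 * (1 + ((k + r - 2 : ℕ) : ℝ) + ((k + r - 2 : ℕ) : ℝ) ^ 2) ≤
      (4 * Real.exp 1 * (r : ℝ) ^ 2 * ((k + r - 2).choose (r - 1))) ^
        (k + r - 2).choose (r - 1) := by
  have hkB : k ≤ (k + r - 2).choose (r - 1) := le_choose_add_sub_two (by omega)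
  set q := k + r - 2 with hq
  set B := q.choose (r - 1)
  have he : (2 : ℝ) ≤ Real.exp 1 := by linarith [Real.add_one_le_exp (1 : ℝ)]
  have hr' : (3 : ℝ) ≤ r := by exact_mod_cast hr
  have hB : (1 : ℝ) ≤ B := by exact_mod_cast hk.trans hkB
  have hrB : (q : ℝ) + 1 ≤ r * B := by
    have h : q + 1 ≤ r * B := by
      calc q + 1 ≤ r * k := by
            obtain ⟨a, rfl⟩ := Nat.exists_eq_add_of_le hk
            have : q + 1 = a + r := by omega
            nlinarith
        _ ≤ r * B := Nat.mul_le_mul_left _ hkB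
    exact_mod_cast h
  have hq0 : (0 : ℝ) ≤ q := Nat.cast_nonneg _
  have hZ : 2 * (r * B : ℝ) ≤ 4 * Real.exp 1 * (r : ℝ) ^ 2 * B := by
    have : (r : ℝ) ≤ r ^ 2 := by nlinarith
    have h2 : (2 : ℝ) * r ≤ 4 * Real.exp 1 * (r : ℝ) ^ 2 := by nlinarith
    nlinarith
  rcases (hk.trans hkB).eq_or_lt with h1 | h1
  · have hk1 : k = 1 := by omega
    have hqr : (q : ℝ) + 1 = r := by
      have : q + 1 = r := by omega
      exact_mod_cast this
    rw [← h1, pow_one, Nat.cast_one, mul_one, ← hqr]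
    nlinarith
  · have h3 : 1 ≤ 4 * Real.exp 1 * (r : ℝ) ^ 2 * B := by nlinarith
    calc 2 * (1 + (q : ℝ) + (q : ℝ) ^ 2) ≤ (2 * (r * B : ℝ)) ^ 2 := by nlinarith
      _ ≤ (4 * Real.exp 1 * (r : ℝ) ^ 2 * B) ^ 2 := pow_le_pow_left₀ (by positivity) hZ _
      _ ≤ _ := pow_le_pow_right₀ h3 h1

theorem exists_forall_pow_le_two_pow {q : ℕ} (hq : 0 < q) : ∃ N : ℕ, ∀ n ≥ N, ∀ t : ℕ,
    n < 2 * (q * t) → (2 * (n : ℝ)) ^ q ≤ 2 ^ t := by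
  have h : ∀ᶠ n : ℕ in Filter.atTop, (n : ℝ) ^ (q * (2 * q)) ≤ (1 / 2 ^ (q * (2 * q))) * 2 ^ n := by
    have := (isLittleO_pow_const_const_pow_of_one_lt (R := ℝ) (q * (2 * q))
      (one_lt_two : (1 : ℝ) < 2)).def (by positivity : (0 : ℝ) < 1 / 2 ^ (q * (2 * q)))
    filter_upwards [this] with n hn
    rwa [Real.norm_of_nonneg (by positivity), Real.norm_of_nonneg (by positivity)] at hn
  obtain ⟨N, hN⟩ := Filter.eventually_atTop.1 h
  refine ⟨N, fun n hn t ht => ?_⟩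
  have h1 : (2 * (n : ℝ)) ^ (q * (2 * q)) ≤ 2 ^ n := by
    rw [mul_pow]
    have := hN n hn
    rwa [one_div, ← div_eq_inv_mul, le_div_iff₀ (by positivity), mul_comm] at this
  refine le_of_pow_le_pow_left₀ (n := 2 * q) (by omega) (by positivity) ?_
  rw [← pow_mul, ← pow_mul]
  refine h1.trans (pow_le_pow_right₀ one_le_two ?_)
  nlinarith

/-- The sum over `τ` of `y ^ |H_σ ∩ H_τ|`, for `y ^ B` at most the ratio of `n` to the critical
constant, is at most a constant multiple of the number of cyclic orderings. -/
theorem sum_NQ_mul_pow_le_mul_QCard {r k n : ℕ} [NeZero n] (hr : 3 ≤ r) (hn : 3 ≤ n)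
    (σ : ZMod n ≃ Fin n) {y : ℝ} (hy : 1 ≤ y)
    (hlarge : ∀ t : ℕ, n < 2 * ((k + r - 2) * t) →
      (2 * y ^ (k + r - 2).choose (r - 1)) ^ (k + r - 2) ≤ 2 ^ t)
    (hab : 2 * y ^ (k + r - 2).choose (r - 1) * Real.exp 1 * (2 * (k + r - 2 : ℕ) + 1) *
      (1 + (k + r - 2 : ℕ) + ((k + r - 2 : ℕ) : ℝ) ^ 2) ≤ n) (S : Finset ℕ) :
    ∑ b ∈ S, (NQ r k n σ b : ℝ) * y ^ b ≤
      2 * Real.exp (Real.exp 1 ^ (k + r - 2 + 1) *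
        ((k + r - 2 : ℕ) * (4 * (k + r - 2 : ℕ) + 1)) * (1 + (k + r - 2 : ℕ))) * QCard n := by
  refine (sum_NQ_mul_pow_le r k n σ (by linarith) S).trans ?_
  set q := k + r - 2
  set B := q.choose (r - 1)
  have hn' : (0 : ℝ) < 2 * n := by positivity
  refine le_of_mul_le_mul_left ?_ hn'
  calc 2 * n * ∑ τ : {τ // IsCycRep n τ},
        y ^ (hamPowEdges r k n σ ∩ hamPowEdges r k n τ.1).card
      ≤ 2 * n * ∑ τ : {τ // IsCycRep n τ},
        (y ^ B) ^ (cycActive q n fun x => τ.2.equiv.symm (σ x)).card := by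
        refine mul_le_mul_of_nonneg_left (Finset.sum_le_sum fun τ _ => ?_) hn'.le
        rw [← pow_mul]
        exact pow_le_pow_right₀ hy (card_inter_hamPowEdges_le hr σ τ.2.equiv)
    _ = ∑ π : Equiv.Perm (ZMod n), (y ^ B) ^ (cycActive q n π).card :=
        (sum_perm_eq_sum_cycRep hn σ (fun s => (y ^ B) ^ s.card) q).symm
    _ ≤ _ := sum_perm_pow_cycActive_le q n (one_le_pow₀ hy) hlarge hab
    _ = _ := by
        rw [factorial_eq_mul_QCard hn σ]
        ring

theorem stmt12 (r k : ℕ) (hr : 3 ≤ r) (hk : 1 ≤ k) :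
    ∃ D : ℝ, 0 < D ∧ ∀ C : ℝ,
      4 * Real.exp 1 * (r : ℝ) ^ 2 * ((k + r - 2).choose (r - 1)) *
          ((2 * (k : ℝ) + 2 * r - 3) * Real.exp 1) ^
            ((1 : ℝ) / ((k + r - 2).choose (r - 1))) ≤ C →
      ∃ N : ℕ, ∀ n ≥ N, ∀ σ : ZMod n → Fin n, IsCycRep n σ →
        (∑ b ∈ Finset.Icc 1 ((k + r - 2).choose (r - 1) * n),
            (NQ r k n σ b : ℝ) *
              (C * (n : ℝ) ^ (-(1 : ℝ) / ((k + r - 2).choose (r - 1)))) ^ (-(b : ℤ)))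
          / (QCard n : ℝ) ≤ D := by
  have hnum := two_mul_le_pow_choose hr hk
  have hBpos : 0 < (k + r - 2).choose (r - 1) := Nat.choose_pos (by omega)
  have hqk : 2 * (k : ℝ) + 2 * r - 3 = 2 * ((k + r - 2 : ℕ) : ℝ) + 1 := by
    have : k + r = (k + r - 2 : ℕ) + 2 := by omega
    have : (k : ℝ) + r = (k + r - 2 : ℕ) + 2 := by exact_mod_cast this
    linarith
  rw [hqk]
  have hedges := fun (n : ℕ) (_ : NeZero n) =>
    sum_NQ_mul_pow_le_mul_QCard (k := k) (n := n) hr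
  obtain ⟨N₀, hN₀⟩ := exists_forall_pow_le_two_pow (show 0 < k + r - 2 by omega)
  set q := k + r - 2
  set B := q.choose (r - 1)
  refine ⟨2 * Real.exp (Real.exp 1 ^ (q + 1) * (q * (4 * q + 1)) * (1 + q)), by positivity,
    fun C hC => ⟨max (max 3 N₀) ⌈C ^ B⌉₊, fun n hn σ hσ => ?_⟩⟩
  simp only [ge_iff_le, max_le_iff, Nat.ceil_le] at hn
  obtain ⟨⟨hn3, hnN⟩, hnC⟩ := hn
  have : NeZero n := ⟨by omega⟩
  have hn0 : (0 : ℝ) < n := by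
    have : 0 < n := by omega
    exact_mod_cast this
  have hB0 : (B : ℝ) ≠ 0 := by exact_mod_cast hBpos.ne'
  have hr0 : (0 : ℝ) < r := by
    have : 0 < r := by omega
    exact_mod_cast this
  have hC0 : 0 < C := lt_of_lt_of_le (by positivity) hC
  have hCB : 2 * (1 + (q : ℝ) + (q : ℝ) ^ 2) * ((2 * q + 1) * Real.exp 1) ≤ C ^ B := by
    refine le_trans ?_ (pow_le_pow_left₀ (by positivity) hC B)
    rw [mul_pow, ← Real.rpow_natCast (_ ^ (1 / (B : ℝ))), ← Real.rpow_mul (by positivity),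
      one_div_mul_cancel hB0, Real.rpow_one]
    exact mul_le_mul_of_nonneg_right hnum (by positivity)
  have hC1 : 1 ≤ C ^ B := by
    refine le_trans ?_ hCB
    have he : (1 : ℝ) ≤ Real.exp 1 := Real.one_le_exp zero_le_one
    have hq0 : (0 : ℝ) ≤ q := Nat.cast_nonneg _
    exact one_le_mul_of_one_le_of_one_le (by nlinarith)
      (one_le_mul_of_one_le_of_one_le (by linarith) he)
  set y := (C * (n : ℝ) ^ (-(1 : ℝ) / B))⁻¹ with hy
  have hyB : y ^ B = n / C ^ B := by
    rw [hy, inv_pow, mul_pow, ← Real.rpow_natCast ((n : ℝ) ^ _), ← Real.rpow_mul hn0.le,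
      div_mul_cancel₀ _ hB0, Real.rpow_neg_one, mul_inv, inv_inv, div_eq_mul_inv, mul_comm]
  have hy1 : 1 ≤ y := by
    have hy0 : 0 ≤ y := by positivity
    refine (one_le_pow_iff_of_nonneg hy0 hBpos.ne').1 ?_
    rw [hyB, le_div_iff₀ (by positivity), one_mul]
    exact hnC
  have hyn : y ^ B ≤ n := by
    rw [hyB]
    exact div_le_self hn0.le hC1
  refine div_le_of_le_mul₀ (Nat.cast_nonneg _) (by positivity) ?_
  simp only [zpow_neg, zpow_natCast, ← inv_pow]
  refine hedges n this hn3 (Equiv.ofBijective σ hσ.1) hy1 (fun t ht => ?_) ?_ _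
  · exact (pow_le_pow_left₀ (by positivity) (by linarith) _).trans (hN₀ n hnN t ht)
  · rw [hyB]
    calc _ = n * (2 * (1 + (q : ℝ) + (q : ℝ) ^ 2) * ((2 * q + 1) * Real.exp 1)) / C ^ B := by ring
      _ ≤ n := by
        rw [div_le_iff₀ (by positivity)]
        exact mul_le_mul_of_nonneg_left hCB hn0.le

end
end

section
/- Let r ≥ 3 and k ≥ 1 be integers and set c₀ = 4er^2·binom(k+r-2, r-1)·((2k+2r-3)e)^{1/binom(k+r-2, r-1)}. For every ε > 0 there exists C₀ ≥ c₀ such that for every C ≥ C₀, with p = C·n^{-1/binom(k+r-2, r-1)}, for all sufficiently large n and every cyclic ordering σ ∈ Q_n one has (1/|Q_n|) · Σ_{b=1}^{m} N_σ(b)·p^{-b} ≤ ε, where m = binom(k+r-2, r-1)·n. -/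
open scoped Classical
open Finset

noncomputable section

theorem pow_mul_factorial_le_exp {n v : ℕ} (hv : v ≤ n) :
    ((n - v).factorial : ℝ) * (n : ℝ) ^ v ≤ n.factorial * Real.exp v := by
  have h1 : n ^ v * v.factorial ≤ v ^ v * n.descFactorial v := by
    rw [← Nat.descFactorial_self v, Nat.descFactorial_eq_prod_range,
      Nat.descFactorial_eq_prod_range]
    have e1 : ∀ m : ℕ, m ^ v = ∏ _i ∈ range v, m := fun m => by simp
    rw [e1, e1, ← Finset.prod_mul_distrib, ← Finset.prod_mul_distrib]
    refine Finset.prod_le_prod' fun i hi => ?_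
    rw [Nat.mul_sub, Nat.mul_sub, mul_comm v n]
    exact Nat.sub_le_sub_left (Nat.mul_le_mul_right i hv) _
  have h2 := Real.pow_div_factorial_le_exp (v : ℝ) (by positivity) v
  rw [div_le_iff₀ (by positivity)] at h2
  have h3 : ((n : ℝ) ^ v * v.factorial) ≤ v ^ v * n.descFactorial v := by exact_mod_cast h1
  have h4 : (n : ℝ) ^ v ≤ Real.exp v * n.descFactorial v := by
    have hf : (0 : ℝ) < v.factorial := by positivity
    refine le_of_mul_le_mul_right (h3.trans ?_) hf
    calc (v : ℝ) ^ v * n.descFactorial v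
        ≤ (Real.exp v * v.factorial) * n.descFactorial v := by gcongr
      _ = _ := by ring
  rw [← Nat.factorial_mul_descFactorial hv]
  push_cast
  calc ((n - v).factorial : ℝ) * (n : ℝ) ^ v
      ≤ (n - v).factorial * (Real.exp v * n.descFactorial v) := by gcongr
    _ = _ := by ring

/-- At most `(|α| - |V|)!` permutations of `α` agree with a given one on `V`. -/
theorem card_perm_eqOn_le {α : Type*} [Fintype α] (V : Finset α)
    (S : Finset (Equiv.Perm α)) (hS : ∀ π ∈ S, ∀ ρ ∈ S, ∀ t ∈ V, π t = ρ t) :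
    S.card ≤ (Fintype.card α - V.card).factorial := by
  rcases S.eq_empty_or_nonempty with rfl | ⟨π₀, h₀⟩
  · simp
  have h1 : Fintype.card {f : Equiv.Perm α // ∀ a, ¬ (a ∉ V) → f a = a}
      = (Fintype.card α - V.card).factorial := by
    rw [← Fintype.card_congr (Equiv.Perm.subtypeEquivSubtypePerm fun a => a ∉ V),
      Fintype.card_perm]
    simp [Fintype.card_subtype_compl]
  rw [← h1, Fintype.card_subtype]
  refine Finset.card_le_card_of_injOn (fun π => π₀⁻¹ * π) ?_ ?_
  · intro π hπ
    simp only [coe_filter, Set.mem_ofPred_eq, Finset.mem_univ, true_and, not_not]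
    intro a ha
    rw [Equiv.Perm.mul_apply, hS π hπ π₀ h₀ a ha]
    simp
  · intro π _ ρ _ h
    exact mul_left_cancel h

/-- If the values of permutations on `D` are prescribed by their values at acyclically chosen
parents, then each element of `D` costs a factor `n`, up to an exponential error. -/
theorem card_perm_parent_mul_le {n : ℕ} [NeZero n] (D : Finset (ZMod n))
    (par off : ZMod n → ZMod n)
    (hpar : ∀ t ∈ D, (par t).val < t.val ∨ par t ∉ D) :
    ((univ.filter fun π : Equiv.Perm (ZMod n) => ∀ t ∈ D, π t = π (par t) + off t).card : ℝ)
      * (n : ℝ) ^ D.card ≤ n.factorial * Real.exp 2 ^ D.card := by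
  set A := univ.filter fun π : Equiv.Perm (ZMod n) => ∀ t ∈ D, π t = π (par t) + off t with hA
  set V := D ∪ D.image par with hV
  have hDV : D ⊆ V := subset_union_left
  have hVn : V.card ≤ n := by
    simpa [ZMod.card] using Finset.card_le_univ V
  have hV2 : V.card ≤ 2 * D.card := by
    rw [hV]
    have := Finset.card_union_le D (D.image par)
    have := Finset.card_image_le (s := D) (f := par)
    omega
  have key : ∀ π ∈ A, ∀ ρ ∈ A, (∀ t ∈ V \ D, π t = ρ t) → ∀ t ∈ V, π t = ρ t := by
    intro π hπ ρ hρ h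
    have : ∀ m : ℕ, ∀ t ∈ V, t.val < m → π t = ρ t := by
      intro m
      induction m with
      | zero => intro t _ h; omega
      | succ m ih =>
        intro t ht hm
        by_cases htD : t ∈ D
        · have hpV : par t ∈ V := mem_union_right _ (mem_image_of_mem _ htD)
          have hp : π (par t) = ρ (par t) := by
            rcases hpar t htD with h' | h'
            · exact ih _ hpV (by omega)
            · exact h _ (mem_sdiff.2 ⟨hpV, h'⟩)
          rw [(mem_filter.1 hπ).2 t htD, (mem_filter.1 hρ).2 t htD, hp]
        · exact h t (mem_sdiff.2 ⟨ht, htD⟩)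
    exact fun t ht => this (t.val + 1) t ht (by omega)
  have hcard : A.card ≤ (n - V.card).factorial * n ^ (V.card - D.card) := by
    have := Finset.card_le_mul_card_image_of_maps_to (s := A)
      (f := fun π : Equiv.Perm (ZMod n) => fun t : {t // t ∈ V \ D} => π t)
      (t := univ) (fun _ _ => mem_univ _) (n - V.card).factorial ?_
    · refine this.trans (le_of_eq ?_)
      congr 1
      rw [Finset.card_univ, Fintype.card_fun, ZMod.card, Fintype.card_coe,
        Finset.card_sdiff_of_subset hDV]
    · intro b _
      have := card_perm_eqOn_le V ({a ∈ A | (fun t : {t // t ∈ V \ D} => a t) = b}) ?_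
      · rwa [ZMod.card] at this
      · intro π hπ ρ hρ
        refine key π (mem_filter.1 hπ).1 ρ (mem_filter.1 hρ).1 fun t ht => ?_
        have := ((mem_filter.1 hπ).2).trans ((mem_filter.1 hρ).2).symm
        exact congrFun this ⟨t, ht⟩
  have hDc := Finset.card_le_card hDV
  calc (A.card : ℝ) * (n : ℝ) ^ D.card
      ≤ ((n - V.card).factorial * (n : ℝ) ^ (V.card - D.card)) * (n : ℝ) ^ D.card := by
        gcongr
        exact_mod_cast hcard
    _ = (n - V.card).factorial * (n : ℝ) ^ V.card := by
        rw [mul_assoc, ← pow_add, Nat.sub_add_cancel hDc]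
    _ ≤ n.factorial * Real.exp V.card := pow_mul_factorial_le_exp hVn
    _ ≤ n.factorial * Real.exp 2 ^ D.card := by
        rw [← Real.exp_nat_mul]
        gcongr
        have : (V.card : ℝ) ≤ 2 * D.card := by exact_mod_cast hV2
        linarith

theorem card_perm_linked_mul_le {n : ℕ} [NeZero n] (w : ℕ) (D : Finset (ZMod n))
    (S : Finset (Equiv.Perm (ZMod n)))
    (hS : ∀ π ∈ S, ∀ t ∈ D, ∃ a x y : Fin w,
      ((t - (a.val : ZMod n)).val < t.val ∨ t - (a.val : ZMod n) ∉ D) ∧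
        π t = π (t - (a.val : ZMod n)) + ((x.val : ZMod n) - (y.val : ZMod n))) :
    (S.card : ℝ) * (n : ℝ) ^ D.card ≤ n.factorial * ((w : ℝ) ^ 3 * Real.exp 2) ^ D.card := by
  let par : ({t // t ∈ D} → Fin w × Fin w × Fin w) → ZMod n → ZMod n := fun c t =>
    if h : t ∈ D then t - ((c ⟨t, h⟩).1.val : ZMod n) else t
  let off : ({t // t ∈ D} → Fin w × Fin w × Fin w) → ZMod n → ZMod n := fun c t =>
    if h : t ∈ D then ((c ⟨t, h⟩).2.1.val : ZMod n) - ((c ⟨t, h⟩).2.2.val : ZMod n) else t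
  let A : ({t // t ∈ D} → Fin w × Fin w × Fin w) → Finset (Equiv.Perm (ZMod n)) := fun c =>
    univ.filter fun π => (∀ t ∈ D, (par c t).val < t.val ∨ par c t ∉ D) ∧
      ∀ t ∈ D, π t = π (par c t) + off c t
  have hsub : S ⊆ univ.biUnion A := by
    intro π hπ
    choose a x y h using hS π hπ
    rw [mem_biUnion]
    refine ⟨fun t => (a t.1 t.2, x t.1 t.2, y t.1 t.2), mem_univ _, ?_⟩
    refine mem_filter.2 ⟨mem_univ _, fun t ht => ?_, fun t ht => ?_⟩
    · simpa only [par, dif_pos ht] using (h t ht).1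
    · simpa only [par, off, dif_pos ht] using (h t ht).2
  have hA : ∀ c, ((A c).card : ℝ) * (n : ℝ) ^ D.card ≤ n.factorial * Real.exp 2 ^ D.card := by
    intro c
    by_cases hc : ∀ t ∈ D, (par c t).val < t.val ∨ par c t ∉ D
    · refine le_trans ?_ (card_perm_parent_mul_le D (par c) (off c) hc)
      gcongr
      exact fun π hπ => mem_filter.2 ⟨mem_univ _, (mem_filter.1 hπ).2.2⟩
    · have : A c = ∅ := Finset.filter_false_of_mem fun π _ h => hc h.1
      rw [this]
      simp only [card_empty, Nat.cast_zero, zero_mul]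
      positivity
  have hcard : (S.card : ℝ) ≤ ∑ c, ((A c).card : ℝ) := by
    exact_mod_cast (Finset.card_le_card hsub).trans Finset.card_biUnion_le
  calc (S.card : ℝ) * (n : ℝ) ^ D.card
      ≤ ∑ c, ((A c).card : ℝ) * (n : ℝ) ^ D.card := by
        rw [← Finset.sum_mul]
        gcongr
    _ ≤ ∑ _c : ({t // t ∈ D} → Fin w × Fin w × Fin w), n.factorial * Real.exp 2 ^ D.card :=
        Finset.sum_le_sum fun c _ => hA c
    _ = n.factorial * ((w : ℝ) ^ 3 * Real.exp 2) ^ D.card := by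
        rw [Finset.sum_const, Finset.card_univ, Fintype.card_fun, Fintype.card_coe,
          nsmul_eq_mul, mul_pow]
        simp only [Fintype.card_prod, Fintype.card_fin]
        push_cast
        ring

/-- The elements of `E` that are preceded by no other element of `E` at distance less than `w`. -/
def runStarts (w : ℕ) (E : Finset ℕ) : Finset ℕ :=
  E.filter fun t => ∀ s ∈ E, s < t → s + w ≤ t

theorem runStarts_insert (w : ℕ) {E : Finset ℕ} {m : ℕ} (hm : ∀ s ∈ E, s < m) :
    (runStarts w (insert m E)).card
      = (runStarts w E).card + if ∀ s ∈ E, s + w ≤ m then 1 else 0 := by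
  have hmE : m ∉ E := fun h => lt_irrefl _ (hm m h)
  have h1 : E.filter (fun t => ∀ s ∈ insert m E, s < t → s + w ≤ t) = runStarts w E := by
    refine Finset.filter_congr fun t ht => ?_
    simp only [mem_insert, forall_eq_or_imp]
    have := hm t ht
    exact ⟨fun h => h.2, fun h => ⟨fun h' => by omega, h⟩⟩
  have h2 : (∀ s ∈ insert m E, s < m → s + w ≤ m) ↔ ∀ s ∈ E, s + w ≤ m := by
    simp only [mem_insert, forall_eq_or_imp, lt_irrefl, false_imp_iff, true_and]
    exact forall₂_congr fun s hs => by simp [hm s hs]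
  rw [runStarts, Finset.filter_insert, h1]
  by_cases h : ∀ s ∈ E, s + w ≤ m
  · rw [if_pos (h2.2 h), if_pos h, card_insert_of_notMem]
    exact fun h' => hmE (mem_filter.1 h').1
  · rw [if_neg (fun h' => h (h2.1 h')), if_neg h, add_zero]

theorem sum_insert_runStarts_le (w n : ℕ) (hn : 0 < n) (hw : 0 < w) {E : Finset ℕ}
    (hE : E.Nonempty) :
    ∑ m ∈ (range n).filter (fun m => ∀ s ∈ E, s < m),
        ((n : ℝ)⁻¹) ^ (runStarts w (insert m E)).card
      ≤ w * ((n : ℝ)⁻¹) ^ (runStarts w E).card := by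
  have hn' : (0 : ℝ) < n := by exact_mod_cast hn
  have hterm : ∀ m ∈ (range n).filter (fun m => ∀ s ∈ E, s < m),
      ((n : ℝ)⁻¹) ^ (runStarts w (insert m E)).card
        ≤ ((n : ℝ)⁻¹) ^ (runStarts w E).card *
          ((if m ∈ Ioo (E.max' hE) (E.max' hE + w) then 1 else 0) + (n : ℝ)⁻¹) := by
    intro m hm
    have hm := (mem_filter.1 hm).2
    rw [runStarts_insert w hm, pow_add]
    gcongr
    by_cases h : ∀ s ∈ E, s + w ≤ m
    · rw [if_pos h, pow_one]
      have : (0 : ℝ) ≤ if m ∈ Ioo (E.max' hE) (E.max' hE + w) then (1 : ℝ) else 0 := by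
        split_ifs <;> norm_num
      linarith
    · rw [if_neg h, pow_zero, if_pos]
      · have : (0 : ℝ) < (n : ℝ)⁻¹ := by positivity
        linarith
      · push Not at h
        obtain ⟨s, hs, hsm⟩ := h
        have := E.le_max' s hs
        exact mem_Ioo.2 ⟨hm _ (E.max'_mem hE), by omega⟩
  refine (Finset.sum_le_sum hterm).trans ?_
  rw [← Finset.mul_sum, mul_comm]
  gcongr
  rw [Finset.sum_add_distrib]
  have h1 : ∑ m ∈ (range n).filter (fun m => ∀ s ∈ E, s < m),
      (if m ∈ Ioo (E.max' hE) (E.max' hE + w) then (1 : ℝ) else 0) ≤ w - 1 := by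
    rw [Finset.sum_ite_mem, Finset.sum_const, nsmul_eq_mul, mul_one]
    have h := Finset.card_le_card (Finset.inter_subset_right
      (s₁ := (range n).filter (fun m => ∀ s ∈ E, s < m))
      (s₂ := Ioo (E.max' hE) (E.max' hE + w)))
    rw [Nat.card_Ioo] at h
    have h' : (#((range n).filter (fun m => ∀ s ∈ E, s < m) ∩
      Ioo (E.max' hE) (E.max' hE + w))) + 1 ≤ w := by omega
    have : ((#((range n).filter (fun m => ∀ s ∈ E, s < m) ∩
      Ioo (E.max' hE) (E.max' hE + w)) : ℕ) : ℝ) + 1 ≤ w := by exact_mod_cast h'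
    linarith
  have h2 : ∑ _m ∈ (range n).filter (fun m => ∀ s ∈ E, s < m), (n : ℝ)⁻¹ ≤ 1 := by
    rw [Finset.sum_const, nsmul_eq_mul, ← div_eq_mul_inv, div_le_one hn']
    have := Finset.card_filter_le (range n) (fun m => ∀ s ∈ E, s < m)
    rw [card_range] at this
    exact_mod_cast this
  linarith

theorem sum_runStarts_powersetCard_le (w n : ℕ) (hn : 0 < n) (hw : 0 < w) (d : ℕ) :
    ∑ E ∈ (powersetCard (d + 1) (range n)).filter (fun E => 0 ∈ E),
        ((n : ℝ)⁻¹) ^ (runStarts w E).card ≤ (n : ℝ)⁻¹ * (w : ℝ) ^ d := by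
  induction d with
  | zero =>
    have : (powersetCard (0 + 1) (range n)).filter (fun E => 0 ∈ E) ⊆ {{0}} := by
      intro E hE
      obtain ⟨h1, h2⟩ := mem_filter.1 hE
      obtain ⟨x, rfl⟩ := Finset.card_eq_one.1 (mem_powersetCard.1 h1).2
      simp only [mem_singleton] at h2
      simp [← h2]
    refine (Finset.sum_le_sum_of_subset_of_nonneg this fun _ _ _ => by positivity).trans ?_
    simp [runStarts, Finset.filter_singleton]
  | succ d ih =>
    set S := fun d => (powersetCard (d + 1) (range n)).filter (fun E => 0 ∈ E) with hS
    have hsub : S (d + 1) ⊆ ((S d).sigma fun E =>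
        (range n).filter (fun m => ∀ s ∈ E, s < m)).image fun p => insert p.2 p.1 := by
      intro E hE
      obtain ⟨h1, h0⟩ := mem_filter.1 hE
      obtain ⟨hEn, hEc⟩ := mem_powersetCard.1 h1
      have hne : E.Nonempty := ⟨0, h0⟩
      have hmax := E.max'_mem hne
      have hpos : E.max' hne ≠ 0 := by
        intro h
        have : E ⊆ {0} := fun s hs => by
          have := E.le_max' s hs
          simp; omega
        have := Finset.card_le_card this
        simp at this; omega
      refine mem_image.2 ⟨⟨E.erase (E.max' hne), E.max' hne⟩, mem_sigma.2 ⟨?_, ?_⟩,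
        insert_erase hmax⟩
      · refine mem_filter.2 ⟨mem_powersetCard.2 ⟨(erase_subset _ _).trans hEn, ?_⟩,
          mem_erase.2 ⟨hpos.symm, h0⟩⟩
        rw [card_erase_of_mem hmax]; omega
      · refine mem_filter.2 ⟨hEn hmax, fun s hs => ?_⟩
        exact lt_of_le_of_ne (E.le_max' s (mem_of_mem_erase hs)) (ne_of_mem_erase hs)
    calc ∑ E ∈ S (d + 1), ((n : ℝ)⁻¹) ^ (runStarts w E).card
        ≤ ∑ E ∈ S d, ∑ m ∈ (range n).filter (fun m => ∀ s ∈ E, s < m),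
            ((n : ℝ)⁻¹) ^ (runStarts w (insert m E)).card := by
          refine (Finset.sum_le_sum_of_subset_of_nonneg hsub
            fun _ _ _ => by positivity).trans ?_
          rw [Finset.sum_sigma']
          exact Finset.sum_image_le_of_nonneg fun _ _ => by positivity
      _ ≤ ∑ E ∈ S d, w * ((n : ℝ)⁻¹) ^ (runStarts w E).card :=
          Finset.sum_le_sum fun E hE =>
            sum_insert_runStarts_le w n hn hw ⟨0, (mem_filter.1 hE).2⟩
      _ ≤ _ := by
          rw [← Finset.mul_sum, pow_succ]
          calc (w : ℝ) * _ ≤ w * ((n : ℝ)⁻¹ * (w : ℝ) ^ d) := by gcongr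
            _ = _ := by ring

/-- The interval of `w` cyclically consecutive positions starting at `i`. -/
def posWindow {n : ℕ} (w : ℕ) (i : ZMod n) : Finset (ZMod n) :=
  (range w).image fun j : ℕ => i + (j : ZMod n)

/-- The `r`-sets of positions contained in a window whose image under `π` is contained in a
window. -/
def sharedSets {n : ℕ} [NeZero n] (r w : ℕ) (π : Equiv.Perm (ZMod n)) :
    Finset (Finset (ZMod n)) :=
  univ.filter fun e => e.card = r ∧ (∃ i, e ⊆ posWindow w i) ∧ ∃ j, e.image π ⊆ posWindow w j

/-- The positions that are last in some shared set. -/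
def lastPos {n : ℕ} [NeZero n] (r w : ℕ) (π : Equiv.Perm (ZMod n)) : Finset (ZMod n) :=
  univ.filter fun t => ∃ e ∈ sharedSets r w π, t ∈ e ∧
    ∀ s ∈ e, s ≠ t → ∃ a : ℕ, 1 ≤ a ∧ a < w ∧ s = t - (a : ZMod n)

/-- The positions that are preceded by another element of a shared set containing them. -/
def linkedPos {n : ℕ} [NeZero n] (r w : ℕ) (π : Equiv.Perm (ZMod n)) : Finset (ZMod n) :=
  univ.filter fun t => ∃ e ∈ sharedSets r w π, t ∈ e ∧
    ∃ a : ℕ, 1 ≤ a ∧ a < w ∧ t - (a : ZMod n) ∈ e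

section Structure

variable {n : ℕ} [NeZero n] {r w : ℕ} {π : Equiv.Perm (ZMod n)}

theorem exists_last {e : Finset (ZMod n)} (he : e ∈ sharedSets r w π) (hne : e.Nonempty) :
    ∃ t ∈ lastPos r w π, t ∈ e ∧
      ∀ s ∈ e, s ≠ t → ∃ a : ℕ, 1 ≤ a ∧ a < w ∧ s = t - (a : ZMod n) := by
  obtain ⟨i, hi⟩ := (mem_filter.1 he).2.2.1
  set X := (range w).filter fun x : ℕ => i + (x : ZMod n) ∈ e with hX
  have hXne : X.Nonempty := by
    obtain ⟨s, hs⟩ := hne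
    obtain ⟨x, hx, rfl⟩ := mem_image.1 (hi hs)
    exact ⟨x, mem_filter.2 ⟨hx, hs⟩⟩
  obtain ⟨hx, hxe⟩ := mem_filter.1 (X.max'_mem hXne)
  have key : ∀ s ∈ e, s ≠ i + ((X.max' hXne : ℕ) : ZMod n) →
      ∃ a : ℕ, 1 ≤ a ∧ a < w ∧ s = i + ((X.max' hXne : ℕ) : ZMod n) - (a : ZMod n) := by
    intro s hs hst
    obtain ⟨y, hy, rfl⟩ := mem_image.1 (hi hs)
    have hyx := X.le_max' y (mem_filter.2 ⟨hy, hs⟩)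
    have hne : y ≠ X.max' hXne := fun h => hst (by rw [← h])
    rw [mem_range] at hx hy
    refine ⟨X.max' hXne - y, by omega, by omega, ?_⟩
    rw [Nat.cast_sub hyx]
    ring
  exact ⟨_, mem_filter.2 ⟨mem_univ _, e, he, hxe, key⟩, hxe, key⟩

theorem card_sharedSets_le (hr : 1 ≤ r) :
    (sharedSets r w π).card ≤ (w - 1).choose (r - 1) * (lastPos r w π).card := by
  have hsub : sharedSets r w π ⊆ (lastPos r w π).biUnion fun t =>
      (powersetCard (r - 1) ((Icc 1 (w - 1)).image fun a : ℕ => t - (a : ZMod n))).image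
        fun f => insert t f := by
    intro e he
    have hcard := (mem_filter.1 he).2.1
    obtain ⟨t, ht, hte, h⟩ := exists_last he (Finset.card_pos.1 (by omega))
    refine mem_biUnion.2 ⟨t, ht, mem_image.2 ⟨e.erase t, mem_powersetCard.2 ⟨?_, ?_⟩,
      insert_erase hte⟩⟩
    · intro s hs
      obtain ⟨a, h1, h2, rfl⟩ := h s (mem_of_mem_erase hs) (ne_of_mem_erase hs)
      exact mem_image.2 ⟨a, mem_Icc.2 ⟨h1, by omega⟩, rfl⟩
    · rw [card_erase_of_mem hte, hcard]
  rw [mul_comm]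
  refine (Finset.card_le_card hsub).trans (Finset.card_biUnion_le_card_mul _ _ _ fun t _ => ?_)
  refine Finset.card_image_le.trans ?_
  rw [card_powersetCard]
  refine Nat.choose_le_choose _ (Finset.card_image_le.trans ?_)
  simp

theorem card_linkedPos_le : (linkedPos r w π).card ≤ r * (sharedSets r w π).card := by
  have hsub : linkedPos r w π ⊆ (sharedSets r w π).biUnion id := by
    intro t ht
    obtain ⟨e, he, hte, _⟩ := (mem_filter.1 ht).2
    exact mem_biUnion.2 ⟨e, he, hte⟩
  rw [mul_comm]
  exact (Finset.card_le_card hsub).trans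
    (Finset.card_biUnion_le_card_mul _ _ _ fun e he => (mem_filter.1 he).2.1.le)

theorem lastPos_subset_linkedPos (hr : 2 ≤ r) : lastPos r w π ⊆ linkedPos r w π := by
  intro t ht
  obtain ⟨e, he, hte, h⟩ := (mem_filter.1 ht).2
  have hcard := (mem_filter.1 he).2.1
  obtain ⟨s, hs, hst⟩ := Finset.exists_mem_ne (by omega : 1 < e.card) t
  obtain ⟨a, h1, h2, rfl⟩ := h s hs hst
  exact mem_filter.2 ⟨mem_univ _, e, he, hte, a, h1, h2, hs⟩

theorem exists_linkedPos_of_lastPos (hr : 3 ≤ r) {t : ZMod n} (ht : t ∈ lastPos r w π) :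
    ∃ a : ℕ, 1 ≤ a ∧ a < w ∧ t - (a : ZMod n) ∈ linkedPos r w π := by
  obtain ⟨e, he, hte, h⟩ := (mem_filter.1 ht).2
  have hcard := (mem_filter.1 he).2.1
  have hc : 1 < (e.erase t).card := by rw [card_erase_of_mem hte]; omega
  obtain ⟨s, hs, s', hs', hne⟩ := Finset.one_lt_card.1 hc
  have hlink : ∀ a b : ℕ, t - (a : ZMod n) ∈ e → t - (b : ZMod n) ∈ e → a < b → b < w →
      t - (a : ZMod n) ∈ linkedPos r w π := by
    intro a b ha hb hab hbw
    refine mem_filter.2 ⟨mem_univ _, e, he, ha, b - a, by omega, by omega, ?_⟩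
    rw [Nat.cast_sub hab.le]
    convert hb using 1
    ring
  obtain ⟨a, h1, h2, rfl⟩ := h s (mem_of_mem_erase hs) (ne_of_mem_erase hs)
  obtain ⟨b, h3, h4, rfl⟩ := h s' (mem_of_mem_erase hs') (ne_of_mem_erase hs')
  rcases lt_trichotomy a b with hab | rfl | hab
  · exact ⟨a, h1, h2, hlink a b (mem_of_mem_erase hs) (mem_of_mem_erase hs') hab h4⟩
  · exact absurd rfl hne
  · exact ⟨b, h3, h4, hlink b a (mem_of_mem_erase hs') (mem_of_mem_erase hs) hab h2⟩

theorem exists_parent_of_linkedPos {t : ZMod n} (ht : t ∈ linkedPos r w π) :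
    ∃ a x y : Fin w, 1 ≤ a.val ∧
      π t = π (t - (a.val : ZMod n)) + ((x.val : ZMod n) - (y.val : ZMod n)) := by
  obtain ⟨e, he, hte, a, h1, h2, hae⟩ := (mem_filter.1 ht).2
  obtain ⟨j, hj⟩ := (mem_filter.1 he).2.2.2
  obtain ⟨x, hx, hx'⟩ := mem_image.1 (hj (mem_image_of_mem π hte))
  obtain ⟨y, hy, hy'⟩ := mem_image.1 (hj (mem_image_of_mem π hae))
  refine ⟨⟨a, h2⟩, ⟨x, mem_range.1 hx⟩, ⟨y, mem_range.1 hy⟩, h1, ?_⟩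
  simp only
  rw [← hx', ← hy']
  ring

theorem val_sub_natCast_lt {t : ZMod n} {a : ℕ} (h1 : 1 ≤ a) (ha : a ≤ t.val) :
    (t - (a : ZMod n)).val < t.val := by
  have hn : a < n := ha.trans_lt (ZMod.val_lt t)
  have hv : (a : ZMod n).val = a := ZMod.val_cast_of_lt hn
  rw [ZMod.val_sub (by rw [hv]; exact ha), hv]
  omega

theorem mem_sharedSets_shift (x : ZMod n) {e : Finset (ZMod n)} :
    e ∈ sharedSets r w ((Equiv.addRight x).trans π) ↔
      e.image (fun t => t + x) ∈ sharedSets r w π := by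
  have hinj : Function.Injective (fun t : ZMod n => t + x) := add_left_injective x
  have himg : e.image ((Equiv.addRight x).trans π) = (e.image fun t => t + x).image π := by
    rw [image_image]
    rfl
  have hwin : (∃ i, e ⊆ posWindow w i) ↔ ∃ i, e.image (fun t => t + x) ⊆ posWindow w i := by
    constructor
    · rintro ⟨i, hi⟩
      refine ⟨i + x, fun s hs => ?_⟩
      obtain ⟨t, ht, rfl⟩ := mem_image.1 hs
      obtain ⟨j, hj, rfl⟩ := mem_image.1 (hi ht)
      exact mem_image.2 ⟨j, hj, by ring⟩
    · rintro ⟨i, hi⟩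
      refine ⟨i - x, fun t ht => ?_⟩
      obtain ⟨j, hj, h⟩ := mem_image.1 (hi (mem_image_of_mem _ ht))
      refine mem_image.2 ⟨j, hj, ?_⟩
      rw [sub_add_eq_add_sub, h]
      ring
  simp only [sharedSets, mem_filter, mem_univ, true_and, card_image_of_injective _ hinj, himg,
    hwin]

theorem mem_linkedPos_shift (x : ZMod n) {t : ZMod n} :
    t ∈ linkedPos r w ((Equiv.addRight x).trans π) ↔ t + x ∈ linkedPos r w π := by
  simp only [linkedPos, mem_filter, mem_univ, true_and]
  constructor
  · rintro ⟨e, he, hte, a, h1, h2, h3⟩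
    refine ⟨_, (mem_sharedSets_shift x).1 he, mem_image_of_mem _ hte, a, h1, h2, ?_⟩
    exact mem_image.2 ⟨_, h3, by ring⟩
  · rintro ⟨e, he, hte, a, h1, h2, h3⟩
    refine ⟨e.image fun s => s - x, (mem_sharedSets_shift x).2 ?_, ?_, a, h1, h2, ?_⟩
    · rw [image_image]
      convert he
      convert Finset.image_id using 2
      · ext s; simp
      · exact Classical.decEq _
    · exact mem_image.2 ⟨_, hte, by ring⟩
    · exact mem_image.2 ⟨_, h3, by ring⟩

end Structure

/-- If every element of `D` has a predecessor in `D` at distance less than `w`, then `D` meets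
every window. -/
theorem le_mul_card_of_closed {n : ℕ} [NeZero n] {w : ℕ} {D : Finset (ZMod n)}
    (hne : D.Nonempty)
    (hD : ∀ t ∈ D, ∃ a : ℕ, 1 ≤ a ∧ a < w ∧ t - (a : ZMod n) ∈ D) : n ≤ w * D.card := by
  obtain ⟨t₀, ht₀⟩ := hne
  have hw : 1 < w := by
    obtain ⟨a, h1, h2, _⟩ := hD t₀ ht₀
    omega
  have hstep : ∀ m : ℕ, ∃ c : ℕ, c < w ∧ t₀ - (m : ZMod n) + (c : ZMod n) ∈ D := by
    intro m
    induction m with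
    | zero => exact ⟨0, by omega, by simpa using ht₀⟩
    | succ m ih =>
      obtain ⟨c, hc, hcD⟩ := ih
      by_cases h : c + 1 < w
      · refine ⟨c + 1, h, ?_⟩
        convert hcD using 1
        push_cast
        ring
      · obtain ⟨a, h1, h2, h3⟩ := hD _ hcD
        refine ⟨c + 1 - a, by omega, ?_⟩
        convert h3 using 1
        rw [Nat.cast_sub (by omega)]
        push_cast
        ring
  have hcover : (univ : Finset (ZMod n)) ⊆
      D.biUnion fun t => (range w).image fun c : ℕ => t - (c : ZMod n) := by
    intro x _
    obtain ⟨c, hc, hcD⟩ := hstep (t₀ - x).val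
    rw [ZMod.natCast_zmod_val] at hcD
    exact mem_biUnion.2 ⟨_, hcD, mem_image.2 ⟨c, mem_range.2 hc, by ring⟩⟩
  have h := (Finset.card_le_card hcover).trans
    (Finset.card_biUnion_le_card_mul _ _ w fun t _ => card_image_le.trans (card_range w).le)
  rw [card_univ, ZMod.card] at h
  linarith [mul_comm w D.card]

/-- The permutations for which `0` starts a run of linked positions. -/
def startPerms (n r w : ℕ) [NeZero n] : Finset (Equiv.Perm (ZMod n)) :=
  univ.filter fun π => 0 ∈ linkedPos r w π ∧
    ∀ a : ℕ, 1 ≤ a → a < w → (0 : ZMod n) - (a : ZMod n) ∉ linkedPos r w π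

/-- The permutations whose linked positions form a single run around the whole cycle. -/
def fullPerms (n r w : ℕ) [NeZero n] : Finset (Equiv.Perm (ZMod n)) :=
  univ.filter fun π => (linkedPos r w π).Nonempty ∧
    ∀ t ∈ linkedPos r w π, ∃ a : ℕ, 1 ≤ a ∧ a < w ∧ t - (a : ZMod n) ∈ linkedPos r w π

section Sums

variable {n : ℕ} [NeZero n] {r w : ℕ}

theorem sub_natCast_eq_zero_sub {t : ZMod n} {a : ℕ} (h : t.val ≤ a) :
    t - (a : ZMod n) = 0 - ((a - t.val : ℕ) : ZMod n) := by
  rw [Nat.cast_sub h, ZMod.natCast_zmod_val]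
  ring

theorem card_lastPos_add_runStarts_le (hr : 3 ≤ r) {π : Equiv.Perm (ZMod n)}
    (hπ : π ∈ startPerms n r w) :
    (lastPos r w π).card + (runStarts w ((linkedPos r w π).image ZMod.val)).card
      ≤ (linkedPos r w π).card := by
  obtain ⟨h0, hgap⟩ := (mem_filter.1 hπ).2
  have hinj : Function.Injective (ZMod.val : ZMod n → ℕ) := ZMod.val_injective n
  rw [← card_image_of_injective (linkedPos r w π) hinj,
    ← card_image_of_injective (lastPos r w π) hinj, ← Finset.card_union_of_disjoint]
  · refine Finset.card_le_card (union_subset (image_subset_image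
      (lastPos_subset_linkedPos (by omega))) (filter_subset _ _))
  · rw [Finset.disjoint_left]
    intro v hv hs
    obtain ⟨t, ht, rfl⟩ := mem_image.1 hv
    obtain ⟨a, h1, h2, h3⟩ := exists_linkedPos_of_lastPos hr ht
    rcases le_or_gt a t.val with ha | ha
    · have hlt := val_sub_natCast_lt h1 ha
      have := (mem_filter.1 hs).2 _ (mem_image_of_mem _ h3) hlt
      have hv : (a : ZMod n).val = a := ZMod.val_cast_of_lt (ha.trans_lt (ZMod.val_lt t))
      rw [ZMod.val_sub (by rw [hv]; exact ha), hv] at this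
      omega
    · rw [sub_natCast_eq_zero_sub ha.le] at h3
      exact hgap _ (by omega) (by omega) h3

theorem sum_startPerms_le (hr : 3 ≤ r) (hw : 0 < w) {y : ℝ} (hy : 0 ≤ y)
    (hKy : (w : ℝ) ^ 3 * Real.exp 2 * y * w ≤ 1 / 2) :
    ∑ π ∈ startPerms n r w, (n : ℝ) ^ (lastPos r w π).card * y ^ (linkedPos r w π).card
      ≤ n.factorial * ((n : ℝ)⁻¹ * (2 * ((w : ℝ) ^ 3 * Real.exp 2 * y))) := by
  have hn : 0 < n := Nat.pos_of_ne_zero (NeZero.ne n)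
  have hn' : (0 : ℝ) < n := by exact_mod_cast hn
  have hn1 : (1 : ℝ) ≤ n := by exact_mod_cast hn
  set K := (w : ℝ) ^ 3 * Real.exp 2 with hK
  have hK0 : 0 ≤ K := by positivity
  let F : Finset ℕ → ℝ := fun E => (K * y) ^ E.card * ((n : ℝ)⁻¹) ^ (runStarts w E).card
  have hF : ∀ E, 0 ≤ F E := fun E => by positivity
  have hinj : Function.Injective (ZMod.val : ZMod n → ℕ) := ZMod.val_injective n
  have hfiber : ∀ D ∈ (univ : Finset (Finset (ZMod n))).filter (fun D => 0 ∈ D),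
      ∑ π ∈ startPerms n r w with linkedPos r w π = D,
        (n : ℝ) ^ (lastPos r w π).card * y ^ (linkedPos r w π).card
      ≤ n.factorial * F (D.image ZMod.val) := by
    intro D _
    set S := (startPerms n r w).filter fun π => linkedPos r w π = D with hS
    have hcount := card_perm_linked_mul_le w D S (by
      intro π hπ t ht
      obtain ⟨hπ1, rfl⟩ := mem_filter.1 hπ
      obtain ⟨a, x, z, ha, h⟩ := exists_parent_of_linkedPos ht
      refine ⟨a, x, z, ?_, h⟩
      rcases le_or_gt a.val t.val with h' | h'
      · exact Or.inl (val_sub_natCast_lt ha h')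
      · right
        rw [sub_natCast_eq_zero_sub h'.le]
        exact (mem_filter.1 hπ1).2.2 _ (by omega) (by omega))
    have hterm : ∀ π ∈ S, (n : ℝ) ^ (lastPos r w π).card * y ^ (linkedPos r w π).card
        ≤ (n : ℝ) ^ D.card * ((n : ℝ)⁻¹) ^ (runStarts w (D.image ZMod.val)).card
          * y ^ D.card := by
      intro π hπ
      obtain ⟨hπ1, rfl⟩ := mem_filter.1 hπ
      have hle := card_lastPos_add_runStarts_le hr hπ1
      gcongr
      rw [inv_pow, ← div_eq_mul_inv, le_div_iff₀ (by positivity), ← pow_add]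
      exact pow_le_pow_right₀ hn1 hle
    refine (Finset.sum_le_sum hterm).trans ?_
    rw [Finset.sum_const, nsmul_eq_mul]
    simp only [F, card_image_of_injective _ hinj]
    calc (S.card : ℝ) * ((n : ℝ) ^ D.card *
          ((n : ℝ)⁻¹) ^ (runStarts w (D.image ZMod.val)).card * y ^ D.card)
        = (S.card * (n : ℝ) ^ D.card) *
          (((n : ℝ)⁻¹) ^ (runStarts w (D.image ZMod.val)).card * y ^ D.card) := by ring
      _ ≤ (n.factorial * K ^ D.card) *
          (((n : ℝ)⁻¹) ^ (runStarts w (D.image ZMod.val)).card * y ^ D.card) := by gcongr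
      _ = _ := by rw [mul_pow]; ring
  have hmaps : ∀ π ∈ startPerms n r w,
      linkedPos r w π ∈ (univ : Finset (Finset (ZMod n))).filter (fun D => 0 ∈ D) :=
    fun π hπ => mem_filter.2 ⟨mem_univ _, (mem_filter.1 hπ).2.1⟩
  rw [← Finset.sum_fiberwise_of_maps_to hmaps]
  refine (Finset.sum_le_sum hfiber).trans ?_
  rw [← Finset.mul_sum]
  refine mul_le_mul_of_nonneg_left ?_ (by positivity)
  have himage : ∑ D ∈ (univ : Finset (Finset (ZMod n))).filter (fun D => 0 ∈ D),
      F (D.image ZMod.val) ≤ ∑ E ∈ (range n).powerset.filter (fun E => 0 ∈ E), F E := by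
    rw [← Finset.sum_image (f := F) (g := fun D : Finset (ZMod n) => D.image ZMod.val)
      (fun _ _ _ _ h => Finset.image_injective hinj h)]
    refine Finset.sum_le_sum_of_subset_of_nonneg ?_ fun _ _ _ => hF _
    intro E hE
    obtain ⟨D, hD, rfl⟩ := mem_image.1 hE
    refine mem_filter.2 ⟨mem_powerset.2 fun v hv => ?_, ?_⟩
    · obtain ⟨t, _, rfl⟩ := mem_image.1 hv
      exact mem_range.2 (ZMod.val_lt t)
    · exact mem_image.2 ⟨0, (mem_filter.1 hD).2, ZMod.val_zero⟩
  refine himage.trans ?_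
  rw [Finset.sum_filter, Finset.sum_powerset, card_range, Finset.sum_range_succ']
  have hzero : ∑ E ∈ powersetCard 0 (range n), (if 0 ∈ E then F E else 0) = 0 := by simp
  rw [hzero, add_zero]
  have hd : ∀ d ∈ range n, ∑ E ∈ powersetCard (d + 1) (range n), (if 0 ∈ E then F E else 0)
      ≤ (n : ℝ)⁻¹ * (K * y) * (1 / 2) ^ d := by
    intro d _
    rw [← Finset.sum_filter]
    have : ∀ E ∈ (powersetCard (d + 1) (range n)).filter (fun E => 0 ∈ E),
        F E = (K * y) ^ (d + 1) * ((n : ℝ)⁻¹) ^ (runStarts w E).card := by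
      intro E hE
      simp only [F, (mem_powersetCard.1 (mem_filter.1 hE).1).2]
    rw [Finset.sum_congr rfl this, ← Finset.mul_sum]
    calc (K * y) ^ (d + 1) * _ ≤ (K * y) ^ (d + 1) * ((n : ℝ)⁻¹ * (w : ℝ) ^ d) := by
          gcongr
          exact sum_runStarts_powersetCard_le w n hn hw d
      _ = (n : ℝ)⁻¹ * (K * y) * (K * y * w) ^ d := by rw [mul_pow _ (w : ℝ)]; ring
      _ ≤ _ := by gcongr
  refine (Finset.sum_le_sum hd).trans ?_
  rw [← Finset.mul_sum]
  have hgeo : ∑ d ∈ range n, (1 / 2 : ℝ) ^ d ≤ 2 := sum_geometric_two_le n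
  calc _ ≤ (n : ℝ)⁻¹ * (K * y) * 2 := by gcongr
    _ = _ := by ring

theorem sum_fullPerms_le (hr : 3 ≤ r) (hw : 0 < w) {y : ℝ} (hy : 0 ≤ y) (hy1 : y ≤ 1) :
    ∑ π ∈ fullPerms n r w,
        (n : ℝ) ^ (lastPos r w π).card * (y ^ w) ^ (linkedPos r w π).card
      ≤ n.factorial * ((n : ℝ) ^ w * (2 * ((w : ℝ) ^ 3 * Real.exp 2) * y) ^ n) := by
  have hn : 0 < n := Nat.pos_of_ne_zero (NeZero.ne n)
  have hn1 : (1 : ℝ) ≤ n := by exact_mod_cast hn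
  set K := (w : ℝ) ^ 3 * Real.exp 2 with hK
  have hK1 : 1 ≤ K := by
    have h1 : (1 : ℝ) ≤ (w : ℝ) ^ 3 := one_le_pow₀ (by exact_mod_cast hw)
    have h2 : (1 : ℝ) ≤ Real.exp 2 := Real.one_le_exp (by norm_num)
    nlinarith
  let T : Equiv.Perm (ZMod n) → Finset (ZMod n) := fun π =>
    (linkedPos r w π).filter fun t => w - 1 ≤ t.val
  have hT : ∀ π, (linkedPos r w π).card ≤ (T π).card + w := by
    intro π
    have hsplit := Finset.card_filter_add_card_filter_not
      (s := linkedPos r w π) (fun t : ZMod n => w - 1 ≤ t.val)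
    have : ((linkedPos r w π).filter fun t => ¬ w - 1 ≤ t.val).card ≤ (range w).card := by
      refine Finset.card_le_card_of_injOn ZMod.val ?_ (ZMod.val_injective n).injOn
      intro t ht
      have := (mem_filter.1 ht).2
      simp only [coe_range, Set.mem_Iio]
      omega
    rw [card_range] at this
    simp only [T]
    omega
  have hfiber : ∀ D ∈ (univ : Finset (Finset (ZMod n))),
      ∑ π ∈ fullPerms n r w with T π = D,
        (n : ℝ) ^ (lastPos r w π).card * (y ^ w) ^ (linkedPos r w π).card
      ≤ n.factorial * ((n : ℝ) ^ w * (K * y) ^ n) := by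
    intro D _
    set S := (fullPerms n r w).filter fun π => T π = D with hS
    have hcount := card_perm_linked_mul_le w D S (by
      intro π hπ t ht
      obtain ⟨_, rfl⟩ := mem_filter.1 hπ
      obtain ⟨htD, htw⟩ := mem_filter.1 ht
      obtain ⟨a, x, z, ha, h⟩ := exists_parent_of_linkedPos htD
      exact ⟨a, x, z, Or.inl (val_sub_natCast_lt ha (by omega)), h⟩)
    have hterm : ∀ π ∈ S, (n : ℝ) ^ (lastPos r w π).card * (y ^ w) ^ (linkedPos r w π).card
        ≤ (n : ℝ) ^ (D.card + w) * y ^ n := by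
      intro π hπ
      obtain ⟨hπ1, rfl⟩ := mem_filter.1 hπ
      obtain ⟨hne, hcl⟩ := (mem_filter.1 hπ1).2
      have h1 := le_mul_card_of_closed hne hcl
      have h2 := Finset.card_le_card (lastPos_subset_linkedPos (n := n) (w := w) (π := π)
        (by omega : 2 ≤ r))
      rw [← pow_mul]
      exact mul_le_mul (pow_le_pow_right₀ hn1 (h2.trans (hT π)))
        (pow_le_pow_of_le_one hy hy1 h1) (by positivity) (by positivity)
    have hDn : D.card ≤ n := by
      simpa [ZMod.card] using Finset.card_le_univ D
    refine (Finset.sum_le_sum hterm).trans ?_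
    rw [Finset.sum_const, nsmul_eq_mul]
    calc (S.card : ℝ) * ((n : ℝ) ^ (D.card + w) * y ^ n)
        = (S.card * (n : ℝ) ^ D.card) * ((n : ℝ) ^ w * y ^ n) := by rw [pow_add]; ring
      _ ≤ (n.factorial * K ^ D.card) * ((n : ℝ) ^ w * y ^ n) := by gcongr
      _ ≤ (n.factorial * K ^ n) * ((n : ℝ) ^ w * y ^ n) := by gcongr
      _ = _ := by rw [mul_pow]; ring
  rw [← Finset.sum_fiberwise_of_maps_to (fun π _ => mem_univ (T π))]
  refine (Finset.sum_le_sum hfiber).trans (le_of_eq ?_)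
  rw [Finset.sum_const, nsmul_eq_mul, card_univ, Fintype.card_finset, ZMod.card, mul_assoc 2,
    mul_pow 2]
  push_cast
  ring

end Sums

theorem factorial_le_two_mul_QCard {n : ℕ} (hn : 3 ≤ n) : n.factorial ≤ 2 * n * QCard n := by
  have : NeZero n := ⟨by omega⟩
  have : Fact (2 < n) := ⟨by omega⟩
  let Q : Finset (ZMod n → Fin n) := univ.filter fun τ => IsCycRep n τ
  have hQ : QCard n = Q.card := by
    rw [QCard, Nat.card_eq_fintype_card, Fintype.card_subtype]
  let g : (ZMod n → Fin n) × ZMod n × Bool → ZMod n → Fin n := fun p t =>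
    p.1 (if p.2.2 then t - p.2.1 else p.2.1 - t)
  have hE : Fintype.card (ZMod n ≃ Fin n) = n.factorial := by
    rw [Fintype.card_equiv (Fintype.equivOfCardEq (by simp [ZMod.card])), ZMod.card]
  have hle : (univ : Finset (ZMod n ≃ Fin n)).card ≤
      ((Q ×ˢ (univ : Finset (ZMod n × Bool))).image g).card := by
    refine Finset.card_le_card_of_injOn (fun ρ => (ρ : ZMod n → Fin n)) ?_
      DFunLike.coe_injective.injOn
    intro ρ _
    rw [mem_coe, mem_image]
    set x := ρ.symm ⟨0, by omega⟩ with hx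
    have h0 : ρ x = ⟨0, by omega⟩ := by simp [hx]
    have hbij : ∀ f : ZMod n ≃ ZMod n, Function.Bijective fun t => ρ (f t) :=
      fun f => (f.trans ρ).bijective
    have hne : (ρ (1 + x)).val ≠ (ρ (-1 + x)).val := by
      intro h
      have h' := ρ.injective (Fin.ext h)
      exact ZMod.neg_one_ne_one (add_right_cancel h').symm
    rcases lt_or_gt_of_ne hne with h | h
    · refine ⟨(fun t => ρ (t + x), x, true), mem_product.2 ⟨mem_filter.2 ⟨mem_univ _,
        hbij (Equiv.addRight x), ?_, h⟩, mem_univ _⟩, ?_⟩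
      · simp [h0]
      · funext t
        simp [g]
    · refine ⟨(fun t => ρ (-t + x), x, false), mem_product.2 ⟨mem_filter.2 ⟨mem_univ _,
        hbij ((Equiv.neg _).trans (Equiv.addRight x)), ?_, ?_⟩, mem_univ _⟩, ?_⟩
      · simp [h0]
      · simpa using h
      · funext t
        simp [g]
  rw [card_univ, hE] at hle
  refine hle.trans (Finset.card_image_le.trans (le_of_eq ?_))
  rw [card_product, hQ, card_univ, Fintype.card_prod, ZMod.card, Fintype.card_bool]
  ring

theorem cycWindow_eq_image (k r n : ℕ) (σ : ZMod n → Fin n) (i : ZMod n) :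
    cycWindow k r n σ i = (posWindow (k + r - 1) i).image σ := by
  ext v
  simp [cycWindow, posWindow]

theorem hamPowEdges_shift (r k n : ℕ) (τ : ZMod n → Fin n) (x : ZMod n) :
    hamPowEdges r k n (fun t => τ (t + x)) = hamPowEdges r k n τ := by
  have h : ∀ i, cycWindow k r n (fun t => τ (t + x)) i = cycWindow k r n τ (i + x) := by
    intro i
    ext v
    simp [cycWindow, add_right_comm]
  ext e
  simp only [hamPowEdges, mem_filter, h]
  refine and_congr_right fun _ => and_congr_right fun _ => ?_
  exact (Equiv.addRight x).exists_congr_left.trans (by simp)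

theorem card_hamPowEdges_inter {n : ℕ} [NeZero n] (r k : ℕ) (σ : ZMod n ≃ Fin n)
    (π : Equiv.Perm (ZMod n)) :
    (hamPowEdges r k n σ ∩ hamPowEdges r k n (fun t => σ (π t))).card
      = (sharedSets r (k + r - 1) π).card := by
  have hinj : Function.Injective fun t => σ (π t) := (π.trans σ).injective
  rw [← card_image_of_injective (sharedSets r (k + r - 1) π) (Finset.image_injective hinj)]
  congr 1
  have himg : ∀ e : Finset (ZMod n), e.image (fun t => σ (π t)) = (e.image π).image σ :=
    fun e => by rw [image_image]; rfl
  have hmem : ∀ e : Finset (ZMod n), e ∈ sharedSets r (k + r - 1) π ↔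
      e.image (fun t => σ (π t)) ∈
        hamPowEdges r k n σ ∩ hamPowEdges r k n (fun t => σ (π t)) := by
    intro e
    simp only [sharedSets, hamPowEdges, mem_inter, mem_filter, mem_univ, true_and,
      cycWindow_eq_image, image_subset_image_iff hinj, card_image_of_injective _ hinj]
    simp only [himg, image_subset_image_iff σ.injective]
    tauto
  ext f
  rw [mem_image]
  constructor
  · intro hf
    have hfe : (f.image (π.trans σ).symm).image (fun t => σ (π t)) = f := by
      rw [image_image]
      convert Finset.image_id using 2
      · ext v; simp
      · exact Classical.decEq _
    exact ⟨_, (hmem _).2 (by rwa [hfe]), hfe⟩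
  · rintro ⟨e, he, rfl⟩
    exact (hmem e).1 he

theorem exists_shift_mem {n : ℕ} [NeZero n] {r w : ℕ} (hr : 2 ≤ r) {π : Equiv.Perm (ZMod n)}
    (hπ : 1 ≤ (sharedSets r w π).card) :
    ∃ x : ZMod n, (Equiv.addRight x).trans π ∈ startPerms n r w ∪ fullPerms n r w := by
  by_cases hfull : π ∈ fullPerms n r w
  · refine ⟨0, mem_union_right _ ?_⟩
    convert hfull
    ext t
    simp
  · obtain ⟨e, he⟩ := Finset.card_pos.1 hπ
    have hcard := (mem_filter.1 he).2.1
    obtain ⟨t, ht, _⟩ := exists_last he (Finset.card_pos.1 (by omega))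
    have hne : (linkedPos r w π).Nonempty := ⟨t, lastPos_subset_linkedPos hr ht⟩
    simp only [fullPerms, mem_filter, mem_univ, true_and, hne] at hfull
    push Not at hfull
    obtain ⟨x, hx, hgap⟩ := hfull
    refine ⟨x, mem_union_left _ (mem_filter.2 ⟨mem_univ _, ?_, fun a h1 h2 h => ?_⟩)⟩
    · rw [mem_linkedPos_shift, zero_add]
      exact hx
    · rw [mem_linkedPos_shift] at h
      refine hgap a h1 h2 ?_
      convert h using 1
      ring

theorem sum_NQ_mul_pow_le_s13 {n : ℕ} [NeZero n] {r k : ℕ} (hr : 2 ≤ r) (m : ℕ)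
    {σ : ZMod n → Fin n} (hσ : Function.Bijective σ) {q : ℝ} (hq : 0 ≤ q) :
    ∑ b ∈ Icc 1 m, (NQ r k n σ b : ℝ) * q ^ b ≤
      ∑ π ∈ startPerms n r (k + r - 1) ∪ fullPerms n r (k + r - 1),
        q ^ (sharedSets r (k + r - 1) π).card := by
  set w := k + r - 1 with hw
  set σ' := Equiv.ofBijective σ hσ with hσ'
  let B : (ZMod n → Fin n) → ℕ := fun τ => (hamPowEdges r k n σ ∩ hamPowEdges r k n τ).card
  let Q : Finset (ZMod n → Fin n) := univ.filter fun τ => IsCycRep n τ ∧ B τ ∈ Icc 1 m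
  have hsum : ∑ b ∈ Icc 1 m, (NQ r k n σ b : ℝ) * q ^ b = ∑ τ ∈ Q, q ^ B τ := by
    rw [← Finset.sum_fiberwise_of_maps_to (t := Icc 1 m) (g := B)
      (fun τ hτ => (mem_filter.1 hτ).2.2)]
    refine Finset.sum_congr rfl fun b hb => ?_
    have hcard : NQ r k n σ b = (Q.filter fun τ => B τ = b).card := by
      rw [NQ, Nat.card_eq_fintype_card, Fintype.card_subtype]
      congr 1
      ext τ
      simp only [Q, B, mem_filter, mem_univ, true_and]
      constructor
      · rintro ⟨h1, h2⟩
        exact ⟨⟨h1, by rwa [h2]⟩, h2⟩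
      · rintro ⟨⟨h1, _⟩, h2⟩
        exact ⟨h1, h2⟩
    rw [hcard, Finset.sum_congr rfl (fun τ hτ => by rw [(mem_filter.1 hτ).2]),
      Finset.sum_const, nsmul_eq_mul]
  have hex : ∀ τ ∈ Q, ∃ π ∈ startPerms n r w ∪ fullPerms n r w, ∃ x : ZMod n,
      ∀ t, σ (π t) = τ (t + x) := by
    intro τ hτ
    obtain ⟨hrep, hB⟩ := (mem_filter.1 hτ).2
    let π : Equiv.Perm (ZMod n) := (Equiv.ofBijective τ hrep.1).trans σ'.symm
    have hπ : ∀ t, σ (π t) = τ t := fun t => by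
      change σ' (σ'.symm _) = _
      simp
    have hc : B τ = (sharedSets r w π).card := by
      rw [← card_hamPowEdges_inter r k σ' π]
      exact congrArg (fun f => (hamPowEdges r k n σ ∩ hamPowEdges r k n f).card)
        (funext fun t => (hπ t).symm)
    obtain ⟨x, hx⟩ := exists_shift_mem hr (hc ▸ (mem_Icc.1 hB).1)
    exact ⟨_, hx, x, fun t => hπ (t + x)⟩
  choose! Ψ hΨ x hx using hex
  have hval : ∀ τ ∈ Q, q ^ B τ = q ^ (sharedSets r w (Ψ τ)).card := by
    intro τ hτ
    rw [← card_hamPowEdges_inter r k σ' (Ψ τ)]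
    have : (fun t => σ' (Ψ τ t)) = fun t => τ (t + x τ) := funext (hx τ hτ)
    rw [this, hamPowEdges_shift]
    rfl
  have hinj : Set.InjOn Ψ Q := by
    intro τ₁ h₁ τ₂ h₂ h
    obtain ⟨hb₁, hz₁, _⟩ := (mem_filter.1 h₁).2.1
    obtain ⟨hb₂, hz₂, _⟩ := (mem_filter.1 h₂).2.1
    have hshift : ∀ t, τ₁ (t + x τ₁) = τ₂ (t + x τ₂) := fun t => by
      rw [← hx τ₁ h₁, ← hx τ₂ h₂, h]
    have h0 : τ₂ (-x τ₁ + x τ₂) = τ₂ 0 := by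
      rw [← hshift, neg_add_cancel]
      exact Fin.ext (hz₁.trans hz₂.symm)
    have hxx := hb₂.1 h0
    have hxx : x τ₂ = x τ₁ := by linear_combination hxx
    funext t
    have := hshift (t - x τ₁)
    rwa [hxx, sub_add_cancel] at this
  rw [hsum, Finset.sum_congr rfl hval,
    ← Finset.sum_image (f := fun π => q ^ (sharedSets r w π).card) hinj]
  refine Finset.sum_le_sum_of_subset_of_nonneg ?_ fun _ _ _ => by positivity
  intro π hπ
  obtain ⟨τ, hτ, rfl⟩ := mem_image.1 hπ
  exact hΨ τ hτ

theorem pow_card_sharedSets_le {n : ℕ} [NeZero n] {r w : ℕ} (hr : 1 ≤ r) {u c y : ℝ}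
    (hu : 1 ≤ u) (hc : 0 ≤ c) (hy : 0 ≤ y) (hy1 : y ≤ 1) (hcy : c ≤ y ^ r)
    (π : Equiv.Perm (ZMod n)) :
    (c * u) ^ (sharedSets r w π).card ≤
      (u ^ (w - 1).choose (r - 1)) ^ (lastPos r w π).card * y ^ (linkedPos r w π).card := by
  rw [mul_pow, mul_comm, ← pow_mul]
  refine mul_le_mul (pow_le_pow_right₀ hu (card_sharedSets_le hr)) ?_ (by positivity)
    (by positivity)
  calc c ^ (sharedSets r w π).card ≤ (y ^ r) ^ (sharedSets r w π).card := by gcongr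
    _ = y ^ (r * (sharedSets r w π).card) := by rw [pow_mul]
    _ ≤ _ := pow_le_pow_of_le_one hy hy1 card_linkedPos_le

theorem eventually_mul_pow_mul_half_pow_le (w : ℕ) {ε : ℝ} (hε : 0 < ε) :
    ∃ N : ℕ, ∀ n ≥ N, 2 * ((n : ℝ) ^ (w + 1) * (1 / 2 : ℝ) ^ n) ≤ ε := by
  have h := tendsto_pow_const_mul_const_pow_of_abs_lt_one (w + 1) (r := (1 / 2 : ℝ))
    (by rw [abs_of_pos] <;> norm_num)
  obtain ⟨N, hN⟩ := Filter.eventually_atTop.1 (h.eventually_le_const (half_pos hε))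
  exact ⟨N, fun n hn => by linarith [hN n hn]⟩

theorem stmt13 (r k : ℕ) (hr : 3 ≤ r) (hk : 1 ≤ k) :
    ∀ ε : ℝ, 0 < ε →
      ∃ C₀ : ℝ,
        4 * Real.exp 1 * (r : ℝ) ^ 2 * ((k + r - 2).choose (r - 1)) *
            ((2 * (k : ℝ) + 2 * r - 3) * Real.exp 1) ^
              ((1 : ℝ) / ((k + r - 2).choose (r - 1))) ≤ C₀ ∧
        ∀ C : ℝ, C₀ ≤ C →
          ∃ N : ℕ, ∀ n ≥ N, ∀ σ : ZMod n → Fin n, IsCycRep n σ →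
            (∑ b ∈ Finset.Icc 1 ((k + r - 2).choose (r - 1) * n),
                (NQ r k n σ b : ℝ) *
                  (C * (n : ℝ) ^ (-(1 : ℝ) / ((k + r - 2).choose (r - 1)))) ^ (-(b : ℤ)))
              / (QCard n : ℝ) ≤ ε := by
  intro ε hε
  set w := k + r - 1 with hw
  have hw0 : 0 < w := by omega
  have hw1 : (1 : ℝ) ≤ w := by exact_mod_cast hw0
  have hwM : k + r - 2 = w - 1 := by omega
  rw [hwM]
  set M := (w - 1).choose (r - 1) with hM
  have hM0 : 0 < M := Nat.choose_pos (by omega)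
  set K := (w : ℝ) ^ 3 * Real.exp 2 with hK
  have hK1 : 1 ≤ K := by
    have h1 : (1 : ℝ) ≤ (w : ℝ) ^ 3 := one_le_pow₀ hw1
    have h2 : (1 : ℝ) ≤ Real.exp 2 := Real.one_le_exp (by norm_num)
    nlinarith
  have hK0 : 0 < K := by linarith
  set y := min (1 / (4 * K * w)) (ε / (8 * K)) with hy
  have hy0 : 0 < y := by positivity
  have hyw : K * y * w ≤ 1 / 4 := by
    have : y * (4 * K * w) ≤ 1 := by
      rw [← le_div_iff₀ (by positivity)]
      exact min_le_left _ _
    linarith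
  have hyK : K * y ≤ 1 / 4 := le_trans (by nlinarith [mul_pos hK0 hy0]) hyw
  have hy1 : y ≤ 1 := by nlinarith
  have hyε : 8 * (K * y) ≤ ε := by
    have : y * (8 * K) ≤ ε := by
      rw [← le_div_iff₀ (by positivity)]
      exact min_le_right _ _
    linarith
  have hywy : y ^ w ≤ y := pow_le_of_le_one hy0.le hy1 hw0.ne'
  refine ⟨max _ (((y ^ w) ^ r)⁻¹), le_max_left _ _, fun C hC => ?_⟩
  have hCy : ((y ^ w) ^ r)⁻¹ ≤ C := (le_max_right _ _).trans hC
  have hC0 : 0 < C := lt_of_lt_of_le (by positivity) hCy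
  obtain ⟨N, hN⟩ := eventually_mul_pow_mul_half_pow_le w (half_pos hε)
  refine ⟨max N 3, fun n hn σ hσ => ?_⟩
  have hn3 : 3 ≤ n := (le_max_right _ _).trans hn
  have : NeZero n := ⟨by omega⟩
  have hn1 : (1 : ℝ) ≤ n := by exact_mod_cast (by omega : 1 ≤ n)
  have hn0 : (0 : ℝ) < n := by linarith
  set u := (n : ℝ) ^ ((1 : ℝ) / M) with hu
  have hu1 : 1 ≤ u := Real.one_le_rpow hn1 (by positivity)
  have huM : u ^ M = n := by
    rw [hu, one_div]
    exact Real.rpow_inv_natCast_pow hn0.le hM0.ne'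
  have hp : ∀ b : ℕ, (C * (n : ℝ) ^ (-(1 : ℝ) / M)) ^ (-(b : ℤ)) = (C⁻¹ * u) ^ b := by
    intro b
    rw [zpow_neg, zpow_natCast, ← inv_pow, mul_inv, neg_div, Real.rpow_neg hn0.le, inv_inv]
  simp only [hp]
  have hwt : ∀ π : Equiv.Perm (ZMod n), (C⁻¹ * u) ^ (sharedSets r w π).card ≤
      (n : ℝ) ^ (lastPos r w π).card * (y ^ w) ^ (linkedPos r w π).card := by
    intro π
    rw [← huM]
    exact pow_card_sharedSets_le (by omega) hu1 (by positivity) (by positivity)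
      (pow_le_one₀ hy0.le hy1) (inv_le_of_inv_le₀ (by positivity) hCy) π
  have hsum : ∑ b ∈ Icc 1 (M * n), (NQ r k n σ b : ℝ) * (C⁻¹ * u) ^ b ≤
      n.factorial * ((n : ℝ)⁻¹ * (2 * (K * y ^ w))) +
        n.factorial * ((n : ℝ) ^ w * (2 * K * y) ^ n) := by
    refine (sum_NQ_mul_pow_le_s13 (by omega) _ hσ.1 (by positivity)).trans ?_
    refine (Finset.sum_le_sum fun π _ => hwt π).trans ?_
    refine le_trans ?_ (add_le_add (sum_startPerms_le (n := n) hr hw0 (by positivity) ?_)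
      (sum_fullPerms_le (n := n) hr hw0 hy0.le hy1))
    · rw [← Finset.sum_union_inter]
      exact le_add_of_nonneg_right (Finset.sum_nonneg fun _ _ => by positivity)
    · calc K * y ^ w * w ≤ K * y * w := by gcongr
        _ ≤ 1 / 2 := by linarith
  have hQ : (n.factorial : ℝ) ≤ 2 * n * QCard n := by
    exact_mod_cast factorial_le_two_mul_QCard hn3
  have hf0 : (0 : ℝ) < n.factorial := by positivity
  have hQ0 : (0 : ℝ) < QCard n := by
    by_contra h
    have : (QCard n : ℝ) = 0 := le_antisymm (not_lt.1 h) (by positivity)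
    rw [this] at hQ
    linarith
  rw [div_le_iff₀ hQ0]
  refine hsum.trans ?_
  have h2 : (2 * K * y) ^ n ≤ (1 / 2 : ℝ) ^ n := by
    refine pow_le_pow_left₀ (by positivity) (by linarith) n
  calc (n.factorial : ℝ) * ((n : ℝ)⁻¹ * (2 * (K * y ^ w))) +
        n.factorial * ((n : ℝ) ^ w * (2 * K * y) ^ n)
      = n.factorial * ((n : ℝ)⁻¹ * (2 * (K * y ^ w)) + (n : ℝ) ^ w * (2 * K * y) ^ n) := by ring
    _ ≤ (2 * n * QCard n) *
        ((n : ℝ)⁻¹ * (2 * (K * y)) + (n : ℝ) ^ w * (1 / 2 : ℝ) ^ n) := by gcongr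
    _ = (4 * (K * y) + 2 * ((n : ℝ) ^ (w + 1) * (1 / 2 : ℝ) ^ n)) * QCard n := by
        field_simp
        ring
    _ ≤ ε * QCard n := by
        have := hN n ((le_max_left _ _).trans hn)
        gcongr
        linarith

end
end
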